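/- arXiv:1310.5919 — 4 statements merged into one kernel-verified Lean document; each statement's English description precedes it below -/
import Mathlib

section
/- Let d ≥ 0, let n_0 ≥ n_1 ≥ … ≥ n_d ≥ 1 be integers, let μ be the Young diagram whose conjugate partition is (n_0, …, n_d), and let N ≥ 0. Then the number of semistandard Young tableaux of shape μ with entries in {0, …, N−1} equals, as a rational number, (∏_{i=0}^d ∏_{k=0}^{n_i−1} (N + i − k)) · V(m_0,…,m_d)/(m_0! ⋯ m_d!), where m_i = n_i + d − i. -/
/-- The Vandermonde product `∏_{i<j} (x i - x j)`. -/
def vmd {k : ℕ} {R : Type*} [CommRing R] (x : Fin k → R) : R :=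
  ∏ i : Fin k, ∏ j ∈ Finset.univ.filter (fun j => i < j), (x i - x j)

/-- `F(N, n_0, …, n_d) = (∏_i ∏_{k<n_i} (N+i-k)) · V(m_0,…,m_d) / (m_0! ⋯ m_d!)`,
where `m_i = n_i + d - i`. -/
def Fq (d N : ℕ) (n : Fin (d + 1) → ℕ) : ℚ :=
  (∏ i : Fin (d + 1), ∏ k ∈ Finset.range (n i), ((N : ℚ) + (i : ℕ) - (k : ℕ))) *
    vmd (fun i : Fin (d + 1) => ((n i + d - (i : ℕ) : ℕ) : ℚ)) /
      ∏ i : Fin (d + 1), (Nat.factorial (n i + d - (i : ℕ)) : ℚ)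

def cz (a : ℕ) (k : ℤ) : ℚ := if 0 ≤ k then (a.choose k.toNat : ℚ) else 0

lemma cz_succ (a : ℕ) (k : ℤ) : cz (a+1) k = cz a (k-1) + cz a k := by
  unfold cz
  rcases lt_trichotomy k 0 with h | h | h
  · simp [not_le.mpr h, show ¬ (1 ≤ k) by omega]
  · subst h; simp
  · obtain ⟨m, rfl⟩ : ∃ m : ℕ, k = m + 1 := ⟨(k-1).toNat, by omega⟩
    rw [if_pos (by omega), if_pos (by omega), if_pos (by omega)]
    have h1 : ((m:ℤ)+1).toNat = m+1 := by omega
    have h2 : ((m:ℤ)+1-1).toNat = m := by omega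
    rw [h1, h2, Nat.choose_succ_succ]; push_cast; ring

def GG (d N : ℕ) (n : Fin (d+1) → ℤ) : ℚ :=
  Matrix.det (Matrix.of fun i j : Fin (d+1) => cz (N + (d - j)) (n i + d - i))

def subv {d : ℕ} (n : Fin (d+1) → ℤ) (s : Finset (Fin (d+1))) (j : Fin (d+1)) : ℤ :=
  n j - if j ∈ s then 1 else 0

def Valid {d : ℕ} (n : Fin (d+1) → ℤ) : Prop := Antitone n ∧ ∀ j, 0 ≤ n j

lemma GG_succ (d N : ℕ) (n : Fin (d+1) → ℤ) :
    GG d (N+1) n = ∑ s : Finset (Fin (d+1)), GG d N (subv n s) := by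
  have := MultilinearMap.map_add_univ (Matrix.detRowAlternating (n := Fin (d+1)) (R := ℚ)).toMultilinearMap
    (fun i j : Fin (d+1) => cz (N + (d - j)) (n i - 1 + d - i))
    (fun i j : Fin (d+1) => cz (N + (d - j)) (n i + d - i))
  unfold GG
  convert this using 1
  · congr 1
    ext i j
    simp only [Matrix.of_apply, Pi.add_apply]
    rw [show N + 1 + (d - (j:ℕ)) = (N + (d - j)) + 1 by omega, cz_succ]
    congr 2; ring
  · refine Finset.sum_congr rfl fun s _ => ?_
    congr 1
    ext i j
    by_cases h : i ∈ s <;> simp [subv, h]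

lemma GG_invalid (d N : ℕ) (n : Fin (d+1) → ℤ) (hn : Valid n) (s : Finset (Fin (d+1)))
    (hs : ¬ Valid (subv n s)) : GG d N (subv n s) = 0 := by
  by_cases ha : Antitone (subv n s)
  · have : ¬ 0 ≤ subv n s (Fin.last d) := by
      intro h
      exact hs ⟨ha, fun j => h.trans (ha (Fin.le_last j))⟩
    unfold GG
    apply Matrix.det_eq_zero_of_row_eq_zero (Fin.last d)
    intro j
    simp only [Matrix.of_apply, cz, Fin.val_last]
    rw [if_neg (by omega)]
  · rw [Fin.antitone_iff_succ_le] at ha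
    push Not at ha
    obtain ⟨i, hi⟩ := ha
    have h1 := hn.1 (Fin.castSucc_lt_succ (i := i)).le
    have h2 : subv n s i.succ = subv n s i.castSucc + 1 := by
      unfold subv at *
      split_ifs at * <;> omega
    unfold GG
    apply Matrix.det_zero_of_row_eq (Fin.castSucc_lt_succ (i := i)).ne
    ext j
    simp only [Matrix.of_apply, h2]
    congr 1
    simp
    ring

lemma GG_zero (d : ℕ) (n : Fin (d+1) → ℤ) (hn : Valid n) :
    GG d 0 n = if n = 0 then 1 else 0 := by
  split_ifs with h
  · subst h
    unfold GG
    have hent : ∀ i j : Fin (d+1), cz (0 + (d - j)) ((0 : Fin (d+1) → ℤ) i + d - i) = ((d - j : ℕ).choose (d - i) : ℚ) := by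
      intro i j
      unfold cz
      rw [if_pos (by simp; omega)]
      congr 2 <;> simp
    rw [Matrix.det_of_isLowerTriangular]
    · simp only [Matrix.of_apply, hent]; simp
    · intro i j hij
      simp only [Matrix.of_apply, hent]
      have : i < j := by simpa using hij
      rw [Nat.choose_eq_zero_of_lt (by omega)]; simp
  · have : 0 < n 0 := by
      by_contra h0
      apply h
      ext j
      have := hn.1 (Fin.zero_le j)
      have := hn.2 j
      simp; omega
    unfold GG
    apply Matrix.det_eq_zero_of_row_eq_zero 0
    intro j
    simp only [Matrix.of_apply, cz]
    rw [if_pos (by simp; omega), Nat.choose_eq_zero_of_lt]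
    · simp
    · simp; omega

def SS (d N : ℕ) (n : Fin (d+1) → ℤ) : Set (Fin (d+1) → ℕ → ℕ) :=
  {T | (∀ j (i : ℕ), (i:ℤ) < n j → T j i < N) ∧
    (∀ j j' (i : ℕ), j < j' → (i:ℤ) < n j' → T j i ≤ T j' i) ∧
    (∀ j (i1 i2 : ℕ), i1 < i2 → (i2:ℤ) < n j → T j i1 < T j i2) ∧
    (∀ j (i : ℕ), ¬ (i:ℤ) < n j → T j i = 0)}

def extT {d : ℕ} (N : ℕ) (n : Fin (d+1) → ℤ) (s : Finset (Fin (d+1))) (T : Fin (d+1) → ℕ → ℕ) :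
    Fin (d+1) → ℕ → ℕ := fun j i =>
  if (i:ℤ) < subv n s j then T j i else if (i:ℤ) < n j then N else 0

lemma subv_le {d : ℕ} (n : Fin (d+1) → ℤ) (s : Finset (Fin (d+1))) (j) :
    subv n s j ≤ n j ∧ n j - 1 ≤ subv n s j := by
  unfold subv; split_ifs <;> omega

lemma extT_mem {d N : ℕ} {n : Fin (d+1) → ℤ} {s : Finset (Fin (d+1))} (hn : Valid n)
    (hs : Valid (subv n s)) {T} (hT : T ∈ SS d N (subv n s)) : extT N n s T ∈ SS d (N+1) n := by
  obtain ⟨h1, h2, h3, h4⟩ := hT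
  refine ⟨?_, ?_, ?_, ?_⟩
  · intro j i hi
    have := h1 j i
    unfold extT
    split_ifs <;> grind
  · intro j j' i hj hi
    have a1 := hs.1 hj.le
    have a2 := hn.1 hj.le
    have := h1 j i
    have := h2 j j' i hj
    unfold extT
    split_ifs <;> grind
  · intro j i1 i2 hi hi2
    have := h1 j i1
    have := h3 j i1 i2 hi
    have := subv_le n s j
    unfold extT
    split_ifs <;> grind
  · intro j i hi
    have := subv_le n s j
    unfold extT
    split_ifs <;> grind

lemma extT_mem_iff {d N : ℕ} {n : Fin (d+1) → ℤ} {s : Finset (Fin (d+1))}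
    (hs : Valid (subv n s)) {T} (hT : T ∈ SS d N (subv n s)) (j) :
    j ∈ s ↔ 0 < n j ∧ extT N n s T j (n j - 1).toNat = N := by
  have h0 := hs.2 j
  have h1 := hT.1 j (n j - 1).toNat
  unfold extT
  by_cases hj : j ∈ s
  · have : subv n s j = n j - 1 := by simp [subv, hj]
    have hp : 0 < n j := by omega
    rw [if_neg (by omega), if_pos (by omega)]
    simp [hj, hp]
  · have : subv n s j = n j := by simp [subv, hj]
    simp only [hj, false_iff]
    rintro ⟨hp, h⟩
    rw [if_pos (by omega)] at h
    have := h1 (by omega)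
    omega

def extMap (d N : ℕ) (n : Fin (d+1) → ℤ) (hn : Valid n) :
    (Σ s : {s : Finset (Fin (d+1)) // Valid (subv n s)}, SS d N (subv n s.1)) → SS d (N+1) n :=
  fun p => ⟨extT N n p.1.1 p.2.1, extT_mem hn p.1.2 p.2.2⟩

lemma extMap_bij (d N : ℕ) (n : Fin (d+1) → ℤ) (hn : Valid n) :
    Function.Bijective (extMap d N n hn) := by
  constructor
  · rintro ⟨⟨s, hs⟩, T, hT⟩ ⟨⟨s', hs'⟩, T', hT'⟩ h
    have h : extT N n s T = extT N n s' T' := congrArg Subtype.val h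
    have e : s = s' := by
      ext j
      rw [extT_mem_iff hs hT, extT_mem_iff hs' hT', h]
    subst e
    have : T = T' := by
      ext j i
      by_cases hi : (i:ℤ) < subv n s j
      · have := congrFun (congrFun h j) i
        simpa [extT, hi] using this
      · rw [hT.2.2.2 j i hi, hT'.2.2.2 j i hi]
    subst this
    rfl
  · rintro ⟨T, hT⟩
    obtain ⟨h1, h2, h3, h4⟩ := id hT
    let s : Finset (Fin (d+1)) := Finset.univ.filter fun j => 0 < n j ∧ T j (n j - 1).toNat = N
    have ms : ∀ j, j ∈ s ↔ 0 < n j ∧ T j (n j - 1).toNat = N := by intro j; simp [s]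
    have k1 : ∀ j (i : ℕ), (i:ℤ) < subv n s j → T j i < N := by
      intro j i hi
      have a := subv_le n s j
      have b := h1 j i (by omega)
      have c := h1 j (n j - 1).toNat (by omega)
      have e := h3 j i (n j - 1).toNat
      by_contra hc
      have : (i : ℤ) = n j - 1 := by
        by_contra hne
        have := e (by omega) (by omega)
        omega
      have hi' : i = (n j - 1).toNat := by omega
      have hj : j ∈ s := (ms j).2 ⟨by omega, by rw [← hi']; omega⟩
      simp [subv, hj] at hi
      omega
    have k2 : ∀ j (i : ℕ), ¬ (i:ℤ) < subv n s j → (i:ℤ) < n j → T j i = N := by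
      intro j i hi hi2
      by_cases hj : j ∈ s
      · simp [subv, hj] at hi
        have hi' : i = (n j - 1).toNat := by omega
        rw [hi']; exact ((ms j).1 hj).2
      · simp [subv, hj] at hi
        omega
    have nn : ∀ j, 0 ≤ subv n s j := by
      intro j
      have := hn.2 j
      by_cases hj : j ∈ s
      · have := ((ms j).1 hj).1
        simp [subv, hj]; omega
      · simp [subv, hj]; omega
    have hs : Valid (subv n s) := by
      refine ⟨?_, nn⟩
      intro j j' hj
      by_contra hc
      have hne : j < j' := lt_of_le_of_ne hj (by rintro rfl; exact hc le_rfl)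
      obtain ⟨i, hi⟩ := Int.eq_ofNat_of_zero_le (nn j)
      have := hn.1 hj
      have := subv_le n s j'
      have e1 := k2 j i (by omega) (by omega)
      have e2 := k1 j' i (by omega)
      have e3 := h2 j j' i hne (by omega)
      omega
    refine ⟨⟨⟨s, hs⟩, fun j i => if (i:ℤ) < subv n s j then T j i else 0, ?_, ?_, ?_, ?_⟩, ?_⟩
    · intro j i hi
      simp only [if_pos hi]; exact k1 j i hi
    · intro j j' i hj hi
      change (i:ℤ) < subv n s j' at hi
      have a := hs.1 hj.le
      have := subv_le n s j'
      simp only [if_pos hi, if_pos (show (i:ℤ) < subv n s j by omega)]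
      exact h2 j j' i hj (by omega)
    · intro j i1 i2 hi hi2
      change (i2:ℤ) < subv n s j at hi2
      have := subv_le n s j
      simp only [if_pos hi2, if_pos (show (i1:ℤ) < subv n s j by omega)]
      exact h3 j i1 i2 hi (by omega)
    · intro j i hi
      simp only [if_neg hi]
    · apply Subtype.ext
      funext j i
      simp only [extMap, extT]
      split_ifs with a b
      · rfl
      · exact (k2 j i a b).symm
      · exact (h4 j i b).symm

lemma SS_card (d N : ℕ) : ∀ n : Fin (d+1) → ℤ, Valid n →
    Finite (SS d N n) ∧ (Nat.card (SS d N n) : ℚ) = GG d N n := by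
  induction N with
  | zero =>
    intro n hn
    rw [GG_zero d n hn]
    by_cases h : n = 0
    · subst h
      have : SS d 0 0 = {0} := by
        ext T
        simp only [Set.mem_singleton_iff]
        constructor
        · intro hT
          ext j i
          exact hT.2.2.2 j i (by simp)
        · rintro rfl
          refine ⟨?_, ?_, ?_, ?_⟩ <;> intros <;> simp_all <;> omega
      rw [this]
      exact ⟨inferInstance, by simp⟩
    · have : SS d 0 n = ∅ := by
        ext T
        simp only [Set.mem_empty_iff_false, iff_false]
        intro hT
        apply h
        ext j
        by_contra hj
        have := hn.2 j
        exact absurd (hT.1 j 0 (by simp at hj; simp; omega)) (by omega)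
      rw [this]
      exact ⟨inferInstance, by simp [h]⟩
  | succ N ih =>
    intro n hn
    have hb := extMap_bij d N n hn
    have : ∀ s : {s : Finset (Fin (d+1)) // Valid (subv n s)}, Finite (SS d N (subv n s.1)) :=
      fun s => (ih _ s.2).1
    refine ⟨Finite.of_surjective _ hb.2, ?_⟩
    classical
    rw [← Nat.card_eq_of_bijective _ hb, Nat.card_sigma, GG_succ]
    push_cast
    rw [Finset.sum_congr rfl fun s _ => (ih _ s.2).2]
    rw [← Finset.sum_subtype (Finset.univ.filter fun s => Valid (subv n s)) (by simp)
      (fun s => GG d N (subv n s))]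
    refine Finset.sum_subset (Finset.subset_univ _) fun s _ h => ?_
    exact GG_invalid d N n hn s (by simpa using h)

lemma GG_eq (d N : ℕ) (n : Fin (d+1) → ℕ) (hmono : ∀ i j : Fin (d + 1), i ≤ j → n j ≤ n i) :
    GG d N (fun i => (n i : ℤ)) = Fq d N n := by
  have hent : ∀ i j : Fin (d+1), cz (N + (d - j)) ((n i : ℤ) + d - i)
      = ((N + (d - j)).choose (n i + d - i) : ℚ) := by
    intro i j
    unfold cz
    rw [if_pos (by omega)]
    congr 2
    omega
  unfold GG
  simp only [hent]
  by_cases h : ∃ i, N + i < n i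
  · obtain ⟨i, hi⟩ := h
    rw [Matrix.det_eq_zero_of_row_eq_zero i]
    · unfold Fq
      rw [Finset.prod_eq_zero (Finset.mem_univ i)]
      · simp
      · apply Finset.prod_eq_zero (Finset.mem_range.2 hi)
        push_cast; ring
    · intro j
      simp only [Matrix.of_apply]
      rw [Nat.choose_eq_zero_of_lt (by omega)]; simp
  · push Not at h
    have hf : ∀ k : ℕ, (k.factorial : ℚ) ≠ 0 := fun k => by exact_mod_cast k.factorial_ne_zero
    have key : ∀ i j : Fin (d+1), ((N + (d - j)).choose (n i + d - i) : ℚ) =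
        ((1 / (((n i + d - i).factorial : ℚ) * ((N + i - n i).factorial : ℚ))) *
         (((N + (d - j)).factorial : ℚ) * (descPochhammer ℚ j).eval ((N + i - n i : ℕ) : ℚ))) := by
      intro i j
      have hi := h i
      rw [descPochhammer_eval_eq_descFactorial]
      by_cases hj : (j : ℕ) ≤ N + i - n i
      · rw [Nat.cast_choose ℚ (by omega)]
        have e := Nat.factorial_mul_descFactorial hj
        have e' : ((N + i - n i - j).factorial : ℚ) * (N + i - n i).descFactorial j
          = (N + i - n i).factorial := by exact_mod_cast e
        rw [show N + (d - (j:ℕ)) - (n i + d - i) = N + i - n i - j by omega]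
        have := hf (N + i - n i - j)
        have := hf (N + i - n i)
        have := hf (n i + d - i)
        rw [← e'] at *
        field_simp
        have : ((N + i - n i).descFactorial j : ℚ) ≠ 0 := by
          intro h0; simp [h0] at *
        field_simp
      · rw [Nat.choose_eq_zero_of_lt (by omega), Nat.descFactorial_of_lt (by omega)]
        simp
    simp only [key]
    have d1 := Matrix.det_mul_column (fun i : Fin (d+1) => (1 / (((n i + d - i).factorial : ℚ) * ((N + i - n i).factorial : ℚ))))
      (Matrix.of fun i j : Fin (d+1) => (((N + (d - j)).factorial : ℚ) * (descPochhammer ℚ j).eval ((N + i - n i : ℕ) : ℚ)))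
    have d2 := Matrix.det_mul_row (fun j : Fin (d+1) => ((N + (d - j)).factorial : ℚ))
      (Matrix.of fun i j : Fin (d+1) => (descPochhammer ℚ j).eval ((N + i - n i : ℕ) : ℚ))
    have d3 := Matrix.det_eval_matrixOfPolynomials_eq_det_vandermonde
      (fun i : Fin (d+1) => ((N + i - n i : ℕ) : ℚ)) (fun j => descPochhammer ℚ j)
      (fun j => by simp) (fun j => monic_descPochhammer ℚ j)
    simp only [Matrix.of_apply] at d1 d2
    rw [d1, d2, ← d3, Matrix.det_vandermonde]
    have hv : ∏ i : Fin (d+1), ∏ j ∈ Finset.Ioi i, (((N + j - n j : ℕ) : ℚ) - ((N + i - n i : ℕ) : ℚ))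
      = vmd (fun i : Fin (d + 1) => ((n i + d - (i : ℕ) : ℕ) : ℚ)) := by
      unfold vmd
      refine Finset.prod_congr rfl fun i _ => ?_
      refine Finset.prod_congr (by ext; simp) fun j _ => ?_
      beta_reduce
      rw [Nat.cast_sub (h i), Nat.cast_sub (h j), Nat.cast_sub (show (i:ℕ) ≤ n i + d by omega),
        Nat.cast_sub (show (j:ℕ) ≤ n j + d by omega)]
      push_cast; ring
    have hr : ∏ j : Fin (d+1), ((N + (d - j)).factorial : ℚ) = ∏ i : Fin (d+1), ((N + i).factorial : ℚ) := by
      rw [← Equiv.prod_comp Fin.revPerm]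
      refine Finset.prod_congr rfl fun i _ => ?_
      simp [Fin.val_rev]
      congr 2; omega
    have hp : ∏ i : Fin (d+1), ((N + i).factorial : ℚ) =
      (∏ i : Fin (d + 1), ∏ k ∈ Finset.range (n i), ((N : ℚ) + (i : ℕ) - (k : ℕ))) *
      ∏ i : Fin (d+1), ((N + i - n i).factorial : ℚ) := by
      rw [← Finset.prod_mul_distrib]
      refine Finset.prod_congr rfl fun i _ => ?_
      rw [← Nat.factorial_mul_descFactorial (h i), Nat.descFactorial_eq_prod_range, mul_comm]
      push_cast
      congr 1
      refine Finset.prod_congr rfl fun k hk => ?_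
      have := h i
      rw [Finset.mem_range] at hk
      rw [Nat.cast_sub (by omega)]; push_cast; rfl
    rw [hv, hr, hp]
    unfold Fq
    have p1 : ∏ i : Fin (d+1), ((N + i - n i).factorial : ℚ) ≠ 0 := Finset.prod_ne_zero_iff.2 fun i _ => hf _
    have p2 : ∏ i : Fin (d+1), ((n i + d - i).factorial : ℚ) ≠ 0 := Finset.prod_ne_zero_iff.2 fun i _ => hf _
    rw [Finset.prod_div_distrib, Finset.prod_mul_distrib]
    simp only [Finset.prod_const_one]
    field_simp

/-- The count of SSYT of shape `μ` (`μ'= (n_0,…,n_d)`) with entries in `{0,…,N-1}` is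
`(∏_i ∏_{k<n_i} (N+i-k)) · V(m_0,…,m_d)/(m_0! ⋯ m_d!)` with `m_i = n_i + d - i`. -/
theorem statement8 (d N : ℕ) (n : Fin (d + 1) → ℕ)
    (hmono : ∀ i j : Fin (d + 1), i ≤ j → n j ≤ n i) (hpos : ∀ i, 1 ≤ n i)
    (μ : YoungDiagram)
    (hμ : ∀ i : ℕ, μ.colLen i = if h : i < d + 1 then n ⟨i, h⟩ else 0) :
    (Nat.card {T : SemistandardYoungTableau μ // ∀ i j : ℕ, (i, j) ∈ μ → T i j < N} : ℚ)
      = Fq d N n := by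
  have hv : Valid (fun i => (n i : ℤ)) :=
    ⟨fun i j h => Int.ofNat_le.2 (hmono i j h), fun j => by simp⟩
  rw [← GG_eq d N n hmono, ← (SS_card d N _ hv).2]
  have mem : ∀ (j : Fin (d+1)) (i : ℕ), (i, (j:ℕ)) ∈ μ ↔ (i:ℤ) < n j := by
    intro j i
    rw [YoungDiagram.mem_iff_lt_colLen, hμ, dif_pos j.2]
    simp
  have nmem : ∀ i j, (i, j) ∈ μ → j < d + 1 := by
    intro i j h
    rw [YoungDiagram.mem_iff_lt_colLen, hμ] at h
    by_contra hc
    simp [hc] at h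
  congr 1
  refine Nat.card_congr
    { toFun := fun T => ⟨fun j i => T.1 i j, ?_, ?_, ?_, ?_⟩
      invFun := fun T => ⟨⟨fun i j => if h : j < d + 1 then T.1 ⟨j, h⟩ i else 0, ?_, ?_, ?_⟩, ?_⟩
      left_inv := ?_
      right_inv := ?_ }
  · intro j i hi
    exact T.2 i j ((mem j i).2 hi)
  · intro j j' i hj hi
    exact T.1.row_weak hj ((mem j' i).2 hi)
  · intro j i1 i2 hi hi2
    exact T.1.col_strict hi ((mem j i2).2 hi2)
  · intro j i hi
    exact T.1.zeros (fun h => hi ((mem j i).1 h))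
  · intro i j1 j2 hj h
    have hl := nmem _ _ h
    rw [dif_pos hl, dif_pos (hj.trans hl)]
    exact T.2.2.1 _ _ i hj ((mem ⟨j2, hl⟩ i).1 h)
  · intro i1 i2 j hi h
    have hl := nmem _ _ h
    rw [dif_pos hl, dif_pos hl]
    exact T.2.2.2.1 _ _ _ hi ((mem ⟨j, hl⟩ i2).1 h)
  · intro i j h
    split_ifs with hl
    · exact T.2.2.2.2 _ _ (fun h' => h ((mem ⟨j, hl⟩ i).2 h'))
    · rfl
  · intro i j h
    have hl := nmem _ _ h
    change (if h : j < d + 1 then T.1 ⟨j, h⟩ i else 0) < N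
    rw [dif_pos hl]
    exact T.2.1 _ _ ((mem ⟨j, hl⟩ i).1 h)
  · intro T
    apply Subtype.ext
    ext i j
    change (if h : j < d + 1 then T.1 i j else 0) = T.1 i j
    split_ifs with hl
    · rfl
    · exact (T.1.zeros (fun h => hl (nmem _ _ h))).symm
  · intro T
    apply Subtype.ext
    funext j i
    change (if h : (j:ℕ) < d + 1 then T.1 ⟨j, h⟩ i else 0) = T.1 j i
    rw [dif_pos j.2]
end

section
/- For every n ∈ ℕ and all elements t, x_0, …, x_n of a commutative ring, Σ_{i=0}^{n} x_i · V(x_0, …, x_{i−1}, x_i − t, x_{i+1}, …, x_n) = (Σ_{i=0}^{n} (x_i − i·t)) · V(x_0, …, x_n). -/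
open Polynomial in
theorem aux_poly {R : Type*} [CommRing R] [Nontrivial R] (n : ℕ) (t : R) (y : Fin (n + 1) → R)
    (j : Fin (n + 1)) : ∃ p : R[X], p.natDegree < n + 1 ∧
      (∀ i, p.eval (y i) = y i * (y i + t) ^ (j : ℕ)) ∧
      p.coeff j = (j : ℕ) • t + if j = Fin.last n then ∑ i, y i else 0 := by
  have hc : ∀ m : ℕ, (X * (X + C t) ^ m : R[X]).coeff m = m • t := by
    intro m
    cases m with
    | zero => simp
    | succ m => rw [coeff_X_mul, coeff_X_add_C_pow]; simp [mul_comm]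
  have hm : ∀ m : ℕ, (X * (X + C t) ^ m : R[X]).Monic := fun m =>
    monic_X.mul ((monic_X_add_C t).pow m)
  have hd : ∀ m : ℕ, (X * (X + C t) ^ m : R[X]).natDegree = m + 1 := by
    intro m
    rw [monic_X.natDegree_mul ((monic_X_add_C t).pow m), (monic_X_add_C t).natDegree_pow]
    simp [add_comm]
  by_cases hj : j = Fin.last n
  · subst hj
    refine ⟨X * (X + C t) ^ n - ∏ i, (X - C (y i)), ?_, ?_, ?_⟩
    · have hN : (∏ i, (X - C (y i))).natDegree = n + 1 := by
        rw [natDegree_finsetProd_X_sub_C_eq_card]; simp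
      have hNm : (∏ i, (X - C (y i))).Monic := monic_prod_X_sub_C _ _
      have := degree_sub_lt_left (p := X * (X + C t) ^ n) (q := ∏ i, (X - C (y i)))
        (by rw [degree_eq_natDegree (hm n).ne_zero, degree_eq_natDegree hNm.ne_zero, hd, hN])
        (hm n).ne_zero (by rw [(hm n).leadingCoeff, hNm.leadingCoeff])
      rw [degree_eq_natDegree (hm n).ne_zero, hd] at this
      by_cases h0 : (X * (X + C t) ^ n - ∏ i, (X - C (y i)) : R[X]) = 0
      · rw [h0]; simp
      · exact (natDegree_lt_iff_degree_lt h0).2 this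
    · intro i
      have : ∏ k, (y i - y k) = 0 := Finset.prod_eq_zero (Finset.mem_univ i) (sub_self _)
      simp [eval_prod, this]
    · have := prod_X_sub_C_coeff_card_pred (Finset.univ : Finset (Fin (n+1))) y (by simp)
      simp only [Finset.card_univ, Fintype.card_fin, Nat.add_sub_cancel] at this
      rw [coeff_sub, Fin.val_last, hc, this]
      simp
  · refine ⟨X * (X + C t) ^ (j : ℕ), ?_, ?_, ?_⟩
    · rw [hd]
      have : (j : ℕ) ≠ n := fun h => hj (Fin.ext h)
      have := j.2
      omega
    · intro i; simp
    · rw [hc, if_neg hj, add_zero]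

theorem aux_det {R : Type*} [CommRing R] (n : ℕ) (t : R) (y : Fin (n + 1) → R) :
    ∑ i : Fin (n + 1), y i * (Matrix.vandermonde (Function.update y i (y i + t))).det
      = (∑ i : Fin (n + 1), (y i + (i : ℕ) • t)) * (Matrix.vandermonde y).det := by
  nontriviality R
  choose p hp1 hp2 hp3 using aux_poly n t y
  set M := Matrix.vandermonde y with hM
  let D : Matrix (Fin (n + 1)) (Fin (n + 1)) R := Matrix.of fun k j => (p j).coeff k
  have hB : ∀ i j, (M * D) i j = y i * (y i + t) ^ (j : ℕ) := by
    intro i j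
    rw [← hp2 j i, Polynomial.eval_eq_sum_range' (hp1 j), Matrix.mul_apply, Finset.sum_range]
    simp [D, hM, Matrix.vandermonde_apply, mul_comm]
  have h1 : ∀ i, y i * (Matrix.vandermonde (Function.update y i (y i + t))).det
      = (M * D * M.adjugate) i i := by
    intro i
    have : Matrix.vandermonde (Function.update y i (y i + t))
        = M.updateRow i (fun j => (y i + t) ^ (j : ℕ)) := by
      ext a b
      by_cases h : a = i
      · subst h; simp [Matrix.vandermonde_apply]
      · simp [Matrix.vandermonde_apply, h, hM]
    rw [this, ← Matrix.det_updateRow_smul]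
    have h2 : (y i • fun j : Fin (n + 1) => (y i + t) ^ (j : ℕ)) = (M * D) i := by
      ext j; rw [hB]; rfl
    rw [h2, ← Matrix.cramer_transpose_apply, Matrix.cramer_eq_adjugate_mulVec,
      ← Matrix.adjugate_transpose, Matrix.mul_apply]
    simp [Matrix.mulVec, dotProduct, mul_comm]
  have h3 : ∑ i, (M * D * M.adjugate) i i = (M * D * M.adjugate).trace := rfl
  rw [Finset.sum_congr rfl fun i _ => h1 i, h3, Matrix.trace_mul_comm, ← Matrix.mul_assoc,
    Matrix.adjugate_mul, Matrix.smul_mul, Matrix.one_mul, Matrix.trace_smul, smul_eq_mul, mul_comm]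
  congr 1
  simp only [Matrix.trace, Matrix.diag, D, Matrix.of_apply, hp3, Finset.sum_add_distrib]
  simp [add_comm]

theorem vmd_eq_det {R : Type*} [CommRing R] {k : ℕ} (x : Fin k → R) :
    vmd x = (Matrix.vandermonde (-x)).det := by
  rw [Matrix.det_vandermonde, vmd]
  refine Finset.prod_congr rfl fun i _ => Finset.prod_congr ?_ fun j _ => ?_
  · ext j; simp
  · simp only [Pi.neg_apply]; ring

/-- `Σ_i x_i · V(x_0, …, x_i − t, …, x_n) = (Σ_i (x_i − i·t)) · V(x_0, …, x_n)`. -/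
theorem statement14 {R : Type*} [CommRing R] (n : ℕ) (t : R) (x : Fin (n + 1) → R) :
    ∑ i : Fin (n + 1), x i * vmd (Function.update x i (x i - t))
      = (∑ i : Fin (n + 1), (x i - (i : ℕ) • t)) * vmd x := by
  have h := aux_det n t (-x)
  have hu : ∀ i, -(Function.update x i (x i - t)) = Function.update (-x) i ((-x) i + t) := by
    intro i
    ext a
    by_cases h : a = i
    · subst h; simp; ring
    · simp [h]
  simp only [vmd_eq_det, hu]
  have e1 : ∑ i : Fin (n + 1), (x i - (i : ℕ) • t)
      = -∑ i : Fin (n + 1), ((-x) i + (i : ℕ) • t) := by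
    rw [← Finset.sum_neg_distrib]
    refine Finset.sum_congr rfl fun i _ => ?_
    simp only [Pi.neg_apply]; ring
  rw [e1, neg_mul, ← h, ← Finset.sum_neg_distrib]
  refine Finset.sum_congr rfl fun i _ => ?_
  simp
end

section
/- Let d ≥ 0 and let n_0 ≥ n_1 ≥ … ≥ n_d ≥ 1 be integers. Then the number of semistandard Young tableaux of shape (n_0, …, n_d) (rows of lengths n_0, …, n_d) with entries in {0, 1, …, d} equals, as a rational number, ∏_{0 ≤ i < j ≤ d} (n_i − n_j + j − i)/(j − i). (Weyl dimension formula form of the count.) -/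
namespace S17

/-- Tableaux with row lengths `r` and entries less than `N`. -/
def S (N : ℕ) (r : ℕ → ℕ) : Set (ℕ → ℕ → ℕ) :=
  {T | (∀ i j, j < r i → T i j < N) ∧ (∀ i j k, j ≤ k → k < r i → T i j ≤ T i k) ∧
    (∀ i k j, i < k → j < r k → T i j < T k j) ∧ (∀ i j, r i ≤ j → T i j = 0)}

/-- Extension by zero. -/
def ext {N : ℕ} (m : Fin N → ℕ) (i : ℕ) : ℕ := if h : i < N then m ⟨i, h⟩ else 0

/-- Interlacing sequences. -/
def I (N : ℕ) (r : ℕ → ℕ) : Finset (Fin N → ℕ) :=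
  Fintype.piFinset (fun i : Fin N => Finset.Icc (r (i + 1)) (r i))

theorem mem_I {N : ℕ} {r : ℕ → ℕ} {m : Fin N → ℕ} :
    m ∈ I N r ↔ ∀ i (_ : i < N), r (i + 1) ≤ ext m i ∧ ext m i ≤ r i := by
  simp only [I, Fintype.mem_piFinset, Finset.mem_Icc, ext]
  constructor
  · intro h i hi
    simpa [hi] using h ⟨i, hi⟩
  · intro h i
    simpa using h i i.2

theorem ext_ge {N : ℕ} (m : Fin N → ℕ) (i : ℕ) (h : N ≤ i) : ext m i = 0 := by
  simp [ext, Nat.not_lt.mpr h]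

theorem ext_le {N : ℕ} {r : ℕ → ℕ} {m : Fin N → ℕ} (hm : m ∈ I N r) (i : ℕ) : ext m i ≤ r i := by
  by_cases h : i < N
  · exact (mem_I.1 hm i h).2
  · rw [ext_ge m i (by omega)]; omega

theorem ext_succ_le {N : ℕ} {r : ℕ → ℕ} {m : Fin N → ℕ} (hm : m ∈ I N r) (i : ℕ) :
    ext m (i + 1) ≤ ext m i := by
  by_cases h : i < N
  · exact (ext_le hm _).trans (mem_I.1 hm i h).1
  · rw [ext_ge m (i+1) (by omega)]; omega

/-- Add the boxes with entry `N`. -/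
def glue (N : ℕ) (r s : ℕ → ℕ) (T : ℕ → ℕ → ℕ) : ℕ → ℕ → ℕ :=
  fun i j => if j < s i then T i j else if j < r i then N else 0

theorem glue_mem {N : ℕ} {r : ℕ → ℕ} (hr : ∀ i, r (i + 1) ≤ r i) (h0 : ∀ i, N < i → r i = 0)
    {m : Fin N → ℕ} (hm : m ∈ I N r) {T : ℕ → ℕ → ℕ} (hT : T ∈ S N (ext m)) :
    glue N r (ext m) T ∈ S (N + 1) r := by
  obtain ⟨h1, h2, h3, h4⟩ := hT
  have ha : Antitone r := antitone_nat_of_succ_le hr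
  have hma : Antitone (ext m) := antitone_nat_of_succ_le (ext_succ_le hm)
  refine ⟨?_, ?_, ?_, ?_⟩
  · intro i j hj
    unfold glue
    split_ifs with h
    · have := h1 i j h
      omega
    · omega
  · intro i j k hjk hk
    unfold glue
    by_cases h : k < ext m i
    · rw [if_pos h, if_pos (by omega)]
      exact h2 i j k hjk h
    · rw [if_neg h, if_pos hk]
      split_ifs with h'
      · exact (h1 i j h').le
      · exact le_rfl
      · omega
  · intro i k j hik hj
    unfold glue
    have h5 := ha (show i + 1 ≤ k from hik)
    have h6 := hma hik.le
    have hkN : k ≤ N := by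
      by_contra h
      rw [h0 k (by omega)] at hj
      omega
    have h7 := (mem_I.1 hm i (by omega)).1
    rw [if_pos (show j < ext m i by omega)]
    split_ifs with h
    · exact h3 i k j hik h
    · exact h1 i j (by omega)
  · intro i j hj
    have := ext_le hm i
    unfold glue
    rw [if_neg (by omega), if_neg (by omega)]

theorem ge_row {N : ℕ} {r : ℕ → ℕ} (hr : ∀ i, r (i + 1) ≤ r i) {T : ℕ → ℕ → ℕ} (hT : T ∈ S N r)
    (i j : ℕ) (hj : j < r i) : i ≤ T i j := by
  induction i with
  | zero => omega
  | succ i ih =>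
    have := hT.2.2.1 i (i+1) j (by omega) hj
    have := ih (hj.trans_le (hr i))
    omega

theorem exists_cut (r : ℕ) (N : ℕ) (f : ℕ → ℕ) (hf : ∀ j k, j ≤ k → k < r → f j ≤ f k) :
    ∃ m ≤ r, ∀ j < r, (f j < N ↔ j < m) := by
  induction r with
  | zero => exact ⟨0, le_rfl, by simp⟩
  | succ r ih =>
    obtain ⟨m, hm, h⟩ := ih (fun j k hjk hk => hf j k hjk (by omega))
    by_cases hN : f r < N
    · refine ⟨r + 1, le_rfl, fun j hj => ?_⟩
      have := hf j r (by omega) (by omega)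
      omega
    · refine ⟨m, by omega, fun j hj => ?_⟩
      rcases Nat.lt_succ_iff_lt_or_eq.1 hj with h' | rfl
      · exact h j h'
      · omega

theorem exists_m {N : ℕ} {r : ℕ → ℕ} (hr : ∀ i, r (i + 1) ≤ r i)
    {T : ℕ → ℕ → ℕ} (hT : T ∈ S (N + 1) r) :
    ∃ m ∈ I N r, ∃ T' ∈ S N (ext m), glue N r (ext m) T' = T := by
  have hge := ge_row hr hT
  obtain ⟨h1, h2, h3, h4⟩ := hT
  choose c hc hcut using fun i => exists_cut (r i) N (T i) (h2 i)
  have hext : ∀ i, N ≤ i → c i = 0 := by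
    intro i hi
    by_contra h
    have a := (hcut i 0 (by have := hc i; omega)).2 (by omega)
    have := hge i 0 (by have := hc i; omega)
    omega
  have he : ext (fun i : Fin N => c i) = c := by
    funext i
    unfold ext
    split_ifs with h
    · rfl
    · exact (hext i (by omega)).symm
  have hm : (fun i : Fin N => c i) ∈ I N r := by
    rw [mem_I, he]
    refine fun i hi => ⟨?_, hc i⟩
    by_contra h
    push Not at h
    have a := h3 i (i+1) (c i) (by omega) h
    have b := h1 (i+1) (c i) h
    have := (hcut i (c i) (h.trans_le (hr i))).1 (by omega)
    omega
  have hca : Antitone c := by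
    have := antitone_nat_of_succ_le (ext_succ_le hm)
    rwa [he] at this
  refine ⟨_, hm, fun i j => if j < c i then T i j else 0, ?_, ?_⟩
  · rw [he]
    refine ⟨?_, ?_, ?_, ?_⟩
    · intro i j hj
      simp only [if_pos hj]
      exact (hcut i j (hj.trans_le (hc i))).2 hj
    · intro i j k hjk hk
      simp only [if_pos hk, if_pos (hjk.trans_lt hk)]
      exact h2 i j k hjk (hk.trans_le (hc i))
    · intro i k j hik hj
      simp only [if_pos hj, if_pos (hj.trans_le (hca hik.le))]
      exact h3 i k j hik (hj.trans_le (hc k))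
    · intro i j hj
      simp only [if_neg (Nat.not_lt.2 hj)]
  · rw [he]
    funext i j
    unfold glue
    split_ifs with h h'
    · exact if_pos h
    · have := hcut i j h'
      have := h1 i j h'
      omega
    · exact (h4 i j (by omega)).symm

theorem glue_inj {N : ℕ} {r : ℕ → ℕ} {m m' : Fin N → ℕ} (hm : m ∈ I N r) (hm' : m' ∈ I N r)
    {T T' : ℕ → ℕ → ℕ} (hT : T ∈ S N (ext m)) (hT' : T' ∈ S N (ext m'))
    (h : glue N r (ext m) T = glue N r (ext m') T') : m = m' ∧ T = T' := by
  have key : ∀ (m : Fin N → ℕ) (_ : m ∈ I N r) (T : ℕ → ℕ → ℕ) (_ : T ∈ S N (ext m)) (i j : ℕ),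
      j < ext m i ↔ j < r i ∧ glue N r (ext m) T i j < N := by
    intro m hm T hT i j
    have := ext_le hm i
    unfold glue
    split_ifs with h h'
    · have := hT.1 i j h
      omega
    · omega
    · omega
  have e : ext m = ext m' := by
    funext i
    apply eq_of_forall_lt_iff
    intro j
    rw [key m hm T hT, key m' hm' T' hT', h]
  refine ⟨?_, ?_⟩
  · funext i
    have := congrFun e i
    simpa [ext] using this
  · funext i j
    by_cases hj : j < ext m i
    · have := congrFun (congrFun h i) j
      unfold glue at this
      rwa [if_pos hj, if_pos (by rwa [← e])] at this
    · rw [hT.2.2.2 i j (by omega), hT'.2.2.2 i j (by rw [← e]; omega)]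

theorem branching {N : ℕ} {r : ℕ → ℕ} (hr : ∀ i, r (i + 1) ≤ r i) (h0 : ∀ i, N < i → r i = 0) :
    Nonempty ((Σ m : {m // m ∈ I N r}, S N (ext m.1)) ≃ S (N + 1) r) := by
  refine ⟨Equiv.ofBijective (fun x => ⟨glue N r (ext x.1.1) x.2.1, glue_mem hr h0 x.1.2 x.2.2⟩)
    ⟨?_, ?_⟩⟩
  · rintro ⟨⟨m, hm⟩, ⟨T, hT⟩⟩ ⟨⟨m', hm'⟩, ⟨T', hT'⟩⟩ h
    obtain ⟨rfl, rfl⟩ := glue_inj hm hm' hT hT' (congrArg Subtype.val h)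
    rfl
  · rintro ⟨T, hT⟩
    obtain ⟨m, hm, T', hT', h⟩ := exists_m hr hT
    exact ⟨⟨⟨m, hm⟩, ⟨T', hT'⟩⟩, Subtype.ext h⟩

/-- binomial polynomial -/
noncomputable def f (j : ℕ) (x : ℚ) : ℚ := (descPochhammer ℚ j).eval x / (j.factorial : ℚ)

theorem f_zero (x : ℚ) : f 0 x = 1 := by simp [f]

theorem f_succ (j : ℕ) (x : ℚ) : f (j + 1) (x + 1) = f (j + 1) x + f j x := by
  have h1 : (descPochhammer ℚ (j + 1)).eval (x + 1) = (x + 1) * (descPochhammer ℚ j).eval x := by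
    rw [descPochhammer_succ_left]
    simp
  have h2 : (descPochhammer ℚ (j + 1)).eval x = (descPochhammer ℚ j).eval x * (x - j) := by
    rw [descPochhammer_succ_right]
    simp
  unfold f
  rw [h1, h2, Nat.factorial_succ]
  have : (j.factorial : ℚ) ≠ 0 := by exact_mod_cast j.factorial_ne_zero
  have : (j : ℚ) + 1 ≠ 0 := by positivity
  push_cast
  field_simp
  ring

theorem f_sum (j p q : ℕ) (x : ℚ) (h : p ≤ q) :
    ∑ a ∈ Finset.Icc p q, f j (x - a) = f (j + 1) (x + 1 - p) - f (j + 1) (x - q) := by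
  induction q, h using Nat.le_induction with
  | base =>
    have := f_succ j (x - p)
    rw [Finset.Icc_self, Finset.sum_singleton, show x + 1 - (p : ℚ) = x - p + 1 by ring, this]
    ring
  | succ q h ih =>
    rw [Finset.sum_Icc_succ_top (by omega), ih]
    have := f_succ j (x - ((q + 1 : ℕ) : ℚ))
    rw [show x - ((q + 1 : ℕ) : ℚ) + 1 = x - q by push_cast; ring] at this
    rw [this]
    ring

/-- determinant -/
noncomputable def D (N : ℕ) (v : ℕ → ℚ) : ℚ :=
  Matrix.det (Matrix.of fun i j : Fin N => f j (v i))

theorem D_succ (N : ℕ) (v : ℕ → ℚ) : D (N + 1) v =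
    Matrix.det (Matrix.of fun i j : Fin N => f (j + 1) (v (i + 1)) - f (j + 1) (v i)) := by
  unfold D
  rw [Matrix.det_eq_of_forall_row_eq_smul_add_pred
    (B := Matrix.of (Fin.cons (fun j : Fin (N + 1) => f j (v 0))
      (fun i : Fin N => fun j : Fin (N + 1) => f j (v (i + 1)) - f j (v i)))) (fun _ => 1)
      (by intro j; simp) (by intro i j; simp)]
  rw [Matrix.det_succ_column_zero, Fin.sum_univ_succ]
  simp [f_zero]
  rfl

theorem D_sum (N : ℕ) (r : ℕ → ℕ) (hr : ∀ i, r (i + 1) ≤ r i) :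
    ∑ m ∈ I N r, D N (fun i => i - ext m i) = D (N + 1) (fun i => i - r i) := by
  rw [D_succ]
  have := (Matrix.detRowAlternating (n := Fin N) (R := ℚ)).toMultilinearMap.map_sum_finset
    (fun (i : Fin N) (a : ℕ) => fun j : Fin N => f j ((i : ℕ) - (a : ℚ)))
    (fun i : Fin N => Finset.Icc (r (i + 1)) (r i))
  have e : (Matrix.of fun i j : Fin N => f (j + 1) ((((i : ℕ) + 1 : ℕ) : ℚ) - r (i + 1))
      - f (j + 1) ((i : ℕ) - r i)) = fun i : Fin N => ∑ a ∈ Finset.Icc (r (i + 1)) (r i),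
        (fun j : Fin N => f j ((i : ℕ) - (a : ℚ))) := by
    funext i j
    rw [Finset.sum_apply, f_sum _ _ _ _ (hr i)]
    simp
  rw [e]
  refine Eq.trans ?_ this.symm
  unfold I
  apply Finset.sum_congr rfl
  intro m hm
  unfold D
  show Matrix.det _ = Matrix.det _
  congr 1
  funext i j
  simp [ext]

/-- product -/
noncomputable def P (N : ℕ) (n : Fin N → ℕ) : ℚ :=
  ∏ i : Fin N, ∏ j ∈ Finset.univ.filter (fun j : Fin N => i < j),
          (((n i : ℚ) - (n j : ℚ) + (j : ℕ) - (i : ℕ)) / ((j : ℕ) - (i : ℕ) : ℚ))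

theorem D_eq (N : ℕ) (v : ℕ → ℚ) : D N v * ∏ j : Fin N, ((j : ℕ).factorial : ℚ) =
    ∏ i : Fin N, ∏ j ∈ Finset.Ioi i, (v j - v i) := by
  rw [← Matrix.det_vandermonde (fun i : Fin N => v i),
    Matrix.det_eval_matrixOfPolynomials_eq_det_vandermonde (fun i : Fin N => v i)
      (fun j => descPochhammer ℚ j) (fun j => descPochhammer_natDegree ℚ j)
      (fun j => monic_descPochhammer ℚ j), mul_comm]
  unfold D
  rw [← Matrix.det_mul_row]
  congr 1
  funext i j
  have : ((j : ℕ).factorial : ℚ) ≠ 0 := by exact_mod_cast (j : ℕ).factorial_ne_zero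
  simp [f]
  field_simp

theorem D_id (N : ℕ) : D N (fun i => (i : ℚ)) = 1 := by
  induction N with
  | zero => simp [D]
  | succ N ih =>
    have := D_sum N (fun _ => 0) (by simp)
    simp only [Nat.cast_zero, sub_zero] at this
    rw [← this, ← ih]
    have : I N (fun _ => 0) = {fun _ => 0} := by
      ext m
      simp [I, funext_iff]
    rw [this]
    simp [ext]

theorem P_eq (N : ℕ) (n : Fin N → ℕ) : P N n = D N (fun i => i - ext n i) := by
  have h1 := D_eq N (fun i => i - ext n i)
  have h2 := D_eq N (fun i => i)
  rw [D_id, one_mul] at h2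
  have h3 : ∏ j : Fin N, ((j : ℕ).factorial : ℚ) ≠ 0 := by
    rw [Finset.prod_ne_zero_iff]
    intro j _
    exact_mod_cast (j : ℕ).factorial_ne_zero
  rw [← eq_div_iff h3, h2] at h1
  rw [h1]
  unfold P
  rw [← Finset.prod_div_distrib]
  refine Finset.prod_congr rfl fun i _ => ?_
  rw [← Finset.prod_div_distrib]
  refine Finset.prod_congr (by ext; simp) fun j _ => ?_
  congr 1
  simp [ext]
  ring

theorem card_S (N : ℕ) : ∀ (r : ℕ → ℕ), (∀ i, r (i + 1) ≤ r i) → (∀ i, N ≤ i → r i = 0) →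
    Finite (S N r) ∧ (Nat.card (S N r) : ℚ) = D N (fun i => i - r i) := by
  induction N with
  | zero =>
    intro r hr h0
    have : S 0 r = {fun _ _ => 0} := by
      ext T
      simp only [S, h0 _ (Nat.zero_le _), Set.mem_ofPred_eq, Set.mem_singleton_iff]
      constructor
      · rintro ⟨_, _, _, h⟩
        funext i j
        exact h i j (Nat.zero_le _)
      · rintro rfl
        simp
    rw [this]
    refine ⟨inferInstance, ?_⟩
    simp [D]
  | succ N ih =>
    intro r hr h0
    obtain ⟨e⟩ := branching (N := N) hr (fun i hi => h0 i hi)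
    have ih' : ∀ m : {m // m ∈ I N r}, _ := fun m =>
      ih (ext m.1) (ext_succ_le m.2) (fun i hi => ext_ge m.1 i hi)
    have hfin : ∀ m : {m // m ∈ I N r}, Finite (S N (ext m.1)) := fun m => (ih' m).1
    refine ⟨Finite.of_equiv _ e, ?_⟩
    rw [← Nat.card_congr e, Nat.card_sigma, ← D_sum N r hr,
      ← Finset.sum_coe_sort (I N r) (fun m => D N (fun i => i - ext m i))]
    push_cast
    exact Finset.sum_congr rfl fun m _ => (ih' m).2

theorem card_eq (d : ℕ) (μ : YoungDiagram) :
    Nat.card {T : SemistandardYoungTableau μ // ∀ i j : ℕ, (i, j) ∈ μ → T i j < d + 1} =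
      Nat.card (S (d + 1) μ.rowLen) := by
  refine Nat.card_congr (Equiv.ofBijective (fun T => ⟨fun i j => T.1 i j, ?_, ?_, ?_, ?_⟩)
    ⟨?_, ?_⟩)
  · intro i j h
    exact T.2 i j (YoungDiagram.mem_iff_lt_rowLen.2 h)
  · intro i j k hjk h
    exact T.1.row_weak_of_le hjk (YoungDiagram.mem_iff_lt_rowLen.2 h)
  · intro i k j hik h
    exact T.1.col_strict hik (YoungDiagram.mem_iff_lt_rowLen.2 h)
  · intro i j h
    exact T.1.zeros (by rw [YoungDiagram.mem_iff_lt_rowLen]; omega)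
  · intro T T' h
    apply Subtype.ext
    ext i j
    exact congrFun (congrFun (congrArg Subtype.val h) i) j
  · rintro ⟨T, h1, h2, h3, h4⟩
    refine ⟨⟨⟨T, ?_, ?_, ?_⟩, ?_⟩, rfl⟩
    · intro i j k hjk h
      exact h2 i j k hjk.le (YoungDiagram.mem_iff_lt_rowLen.1 h)
    · intro i k j hik h
      exact h3 i k j hik (YoungDiagram.mem_iff_lt_rowLen.1 h)
    · intro i j h
      rw [YoungDiagram.mem_iff_lt_rowLen] at h
      exact h4 i j (by omega)
    · intro i j h
      exact h1 i j (YoungDiagram.mem_iff_lt_rowLen.1 h)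

end S17

/-- For `n_0 ≥ … ≥ n_d ≥ 1` and `μ` the Young diagram with rows `(n_0, …, n_d)`, the
number of semistandard Young tableaux of shape `μ` with entries in `{0, 1, …, d}` equals
`∏_{0 ≤ i < j ≤ d} (n_i - n_j + j - i)/(j - i)` (Weyl dimension formula form). -/
theorem statement17 (d : ℕ) (n : Fin (d + 1) → ℕ)
    (hmono : ∀ i j : Fin (d + 1), i ≤ j → n j ≤ n i) (hpos : ∀ i, 1 ≤ n i)
    (μ : YoungDiagram)
    (hμ : ∀ i : ℕ, μ.rowLen i = if h : i < d + 1 then n ⟨i, h⟩ else 0) :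
    (Nat.card {T : SemistandardYoungTableau μ // ∀ i j : ℕ, (i, j) ∈ μ → T i j < d + 1} : ℚ)
      = ∏ i : Fin (d + 1), ∏ j ∈ Finset.univ.filter (fun j : Fin (d + 1) => i < j),
          (((n i : ℚ) - (n j : ℚ) + (j : ℕ) - (i : ℕ)) / ((j : ℕ) - (i : ℕ) : ℚ)) := by
  have he : μ.rowLen = S17.ext n := funext hμ
  rw [S17.card_eq, (S17.card_S (d + 1) μ.rowLen (fun i => μ.rowLen_anti i (i + 1) (by omega))
    (fun i hi => by rw [he]; exact S17.ext_ge n i hi)).2, he, ← S17.P_eq]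
  rfl
end

section
/- Let d ≥ 0, let n_0 ≥ n_1 ≥ … ≥ n_d ≥ 1 be integers, let μ be the Young diagram whose conjugate partition is (n_0, …, n_d), and let N ≥ n_0. Let T(N,μ) be the number of SSYT of shape μ with entries in {1,…,N}; let 𝐓^C(N,μ) be the number of fillings of μ with positive integers, strictly increasing down each column, such that every entry in column i is at most N + i; let T_0(μ') be the number of SSYT of shape (n_0,…,n_d) with entries in {1,…,d+1}; let 𝐓_0^R(μ') be the number of fillings of the diagram with rows (n_0,…,n_d) with weakly increasing rows such that every entry in row j lies in {j+1, …, d+1}; let T^*(μ) be the number of standard Young tableaux of shape μ; and let 𝐓^*(μ) be the number of fillings of μ using each of 1,…,|μ| exactly once with entries increasing down each column. Then, as rational numbers, T(N,μ)/𝐓^C(N,μ) = T_0(μ')/𝐓_0^R(μ') = T^*(μ)/𝐓^*(μ) = (n_0! ⋯ n_d!)/(∏_{(i,j)∈μ} h(i,j)). -/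
/-- The hook length of the cell `(i, j)` (row `i`, column `j`, `0`-indexed) of a Young
diagram `μ`: `h(i,j) = (μ_i - j) + (μ'_j - i) - 1`. -/
def hookLen (μ : YoungDiagram) (i j : ℕ) : ℕ :=
  (μ.rowLen i - j) + (μ.colLen j - i) - 1

/-- `T(N,μ)`: the number of SSYT of shape `μ` (weakly increasing rows, strictly
increasing columns) with entries in `{1, …, N}` (fillings are `0` outside `μ`). -/
noncomputable def Tcount (μ : YoungDiagram) (N : ℕ) : ℕ :=
  Nat.card {f : ℕ → ℕ → ℕ //
    (∀ i j, (i, j) ∉ μ → f i j = 0) ∧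
    (∀ i j, (i, j) ∈ μ → 1 ≤ f i j ∧ f i j ≤ N) ∧
    (∀ i j₁ j₂, j₁ ≤ j₂ → (i, j₂) ∈ μ → f i j₁ ≤ f i j₂) ∧
    (∀ i₁ i₂ j, i₁ < i₂ → (i₂, j) ∈ μ → f i₁ j < f i₂ j)}

/-- `𝐓^C(N,μ)`: the number of fillings of `μ` with positive integers, strictly
increasing down each column, whose entries in column `j` are at most `N + j`. -/
noncomputable def TCcount (μ : YoungDiagram) (N : ℕ) : ℕ :=
  Nat.card {f : ℕ → ℕ → ℕ //
    (∀ i j, (i, j) ∉ μ → f i j = 0) ∧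
    (∀ i j, (i, j) ∈ μ → 1 ≤ f i j ∧ f i j ≤ N + j) ∧
    (∀ i₁ i₂ j, i₁ < i₂ → (i₂, j) ∈ μ → f i₁ j < f i₂ j)}

/-- `𝐓_0^R(ν)` (with `d + 1` available values): the number of fillings of `ν` with
weakly increasing rows whose entries in row `i` lie in `{i+1, …, d+1}`. -/
noncomputable def TRcount (ν : YoungDiagram) (d : ℕ) : ℕ :=
  Nat.card {f : ℕ → ℕ → ℕ //
    (∀ i j, (i, j) ∉ ν → f i j = 0) ∧
    (∀ i j, (i, j) ∈ ν → i + 1 ≤ f i j ∧ f i j ≤ d + 1) ∧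
    (∀ i j₁ j₂, j₁ ≤ j₂ → (i, j₂) ∈ ν → f i j₁ ≤ f i j₂)}

/-- `T^*(μ)`: the number of standard Young tableaux of shape `μ` (bijective fillings
with `1, …, |μ|` increasing along rows and down columns). -/
noncomputable def sytCount (μ : YoungDiagram) : ℕ :=
  Nat.card {f : ℕ → ℕ → ℕ //
    (∀ i j, (i, j) ∉ μ → f i j = 0) ∧
    Set.BijOn (fun c : ℕ × ℕ => f c.1 c.2) ↑μ.cells (Set.Icc 1 μ.card) ∧
    (∀ i j₁ j₂, j₁ < j₂ → (i, j₂) ∈ μ → f i j₁ < f i j₂) ∧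
    (∀ i₁ i₂ j, i₁ < i₂ → (i₂, j) ∈ μ → f i₁ j < f i₂ j)}

/-- `𝐓^*(μ)`: the number of fillings of `μ` using each of `1, …, |μ|` exactly once with
entries increasing down each column (no condition on rows). -/
noncomputable def colStrictBijCount (μ : YoungDiagram) : ℕ :=
  Nat.card {f : ℕ → ℕ → ℕ //
    (∀ i j, (i, j) ∉ μ → f i j = 0) ∧
    Set.BijOn (fun c : ℕ × ℕ => f c.1 c.2) ↑μ.cells (Set.Icc 1 μ.card) ∧
    (∀ i₁ i₂ j, i₁ < i₂ → (i₂, j) ∈ μ → f i₁ j < f i₂ j)}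


/-- determinant of binomials -/
def binDet (m : ℕ) (a : Fin m → ℕ) : ℤ :=
  (Matrix.of fun i j : Fin m => ((a i).choose (j : ℕ) : ℤ)).det

lemma sum_Ico_choose_sub (a b j : ℕ) (h : a ≤ b) :
    ∑ k ∈ Finset.Ico a b, (k.choose j : ℤ) = (b.choose (j+1) : ℤ) - a.choose (j+1) := by
  induction b, h using Nat.le_induction with
  | base => simp
  | succ b hb ih =>
    rw [Finset.sum_Ico_succ_top hb, ih, Nat.choose_succ_succ]; push_cast; ring

lemma binDet_succ (m : ℕ) (a : Fin (m+1) → ℕ) (ha : ∀ i : Fin m, a i.castSucc ≤ a i.succ) :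
    binDet (m+1) a = ∑ k ∈ Fintype.piFinset (fun i : Fin m => Finset.Ico (a i.castSucc) (a i.succ)),
      binDet m k := by
  have h1 : binDet (m+1) a = (Matrix.of fun i j : Fin (m+1) =>
      (Fin.cases ((a 0).choose (j : ℕ) : ℤ)
        (fun i' => ((a i'.succ).choose (j : ℕ) : ℤ) - (a i'.castSucc).choose (j : ℕ)) i : ℤ)).det := by
    unfold binDet
    apply Matrix.det_eq_of_forall_row_eq_smul_add_pred (fun _ => 1)
    · intro j; simp
    · intro i j; simp
  rw [h1, Matrix.det_succ_column_zero, Fin.sum_univ_succ]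
  simp only [Matrix.of_apply, Fin.cases_zero, Fin.cases_succ, Fin.val_zero, Nat.choose_zero_right]
  simp only [Nat.cast_one, sub_self, mul_zero, zero_mul, Finset.sum_const_zero, add_zero, pow_zero, one_mul]
  have h2 := (Matrix.detRowAlternating (R := ℤ) (n := Fin m)).toMultilinearMap.map_sum_finset
    (fun (i : Fin m) (k : ℕ) => (fun j : Fin m => (k.choose (j : ℕ) : ℤ)))
    (fun i : Fin m => Finset.Ico (a i.castSucc) (a i.succ))
  change _ = ∑ k ∈ Fintype.piFinset (fun i : Fin m => Finset.Ico (a i.castSucc) (a i.succ)), (Matrix.of fun i j : Fin m => ((k i).choose (j : ℕ) : ℤ)).det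
  refine Eq.trans ?_ h2
  change _ = Matrix.det _
  congr 1
  ext i j
  simp only [Matrix.submatrix_apply, Matrix.of_apply, Fin.succAbove_zero, Fin.cases_succ, Finset.sum_apply]
  rw [sum_Ico_choose_sub _ _ _ (ha i)]
  simp

lemma binDet_mul (m : ℕ) (a : Fin m → ℕ) :
    (∏ i : Fin m, ((Nat.factorial (i : ℕ) : ℕ) : ℤ)) * binDet m a =
      ∏ i : Fin m, ∏ j ∈ Finset.Ioi i, ((a j : ℤ) - a i) := by
  rw [← Matrix.det_vandermonde, Matrix.det_eval_matrixOfPolynomials_eq_det_vandermonde (fun i ↦ ((a i : ℕ) : ℤ))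
      (fun i => descPochhammer ℤ i)
      (fun i => descPochhammer_natDegree ℤ i)
      (fun i => monic_descPochhammer ℤ i), binDet, ← Matrix.det_mul_row]
  congr 1
  ext i j
  simp only [Matrix.of_apply]
  rw [descPochhammer_eval_eq_descFactorial, Nat.descFactorial_eq_factorial_mul_choose]
  push_cast; rfl

lemma binDet_mul' (m : ℕ) (a : ℕ → ℕ) :
    (∏ i ∈ Finset.range m, ((Nat.factorial i : ℕ) : ℤ)) * binDet m (fun i => a i) =
      ∏ t ∈ Finset.range m, ∏ s ∈ Finset.range t, ((a t : ℤ) - a s) := by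
  rw [← Fin.prod_univ_eq_prod_range, binDet_mul, ← Fin.prod_univ_eq_prod_range (fun t => ∏ s ∈ Finset.range t, ((a t : ℤ) - a s))]
  rw [Finset.prod_comm' (t' := Finset.univ) (s' := fun j => Finset.Iio j) (by simp)]
  apply Finset.prod_congr rfl
  intro t _
  apply Finset.prod_nbij (fun i : Fin m => (i : ℕ))
  · simp
  · intro i _ j _ h; exact Fin.ext h
  · intro s hs
    simp at hs
    exact ⟨⟨s, hs.trans t.2⟩, by simpa [Fin.lt_def] using hs, rfl⟩
  · simp

lemma row_hook (r c : ℕ → ℕ) (hrc : ∀ i j, j < r i ↔ i < c j) (m t : ℕ) (ht : t < m)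
    (hr : ∀ i, m ≤ i → r i = 0) :
    (∏ j ∈ Finset.range (r (m-1-t)), ((r (m-1-t) - j) + (c j - (m-1-t)) - 1)) *
      ∏ s ∈ Finset.range t, ((r (m-1-t) + t) - (r (m-1-s) + s)) = (r (m-1-t) + t).factorial := by
  have hanti : ∀ i i', i ≤ i' → r i' ≤ r i := by
    intro i i' h
    by_contra hlt
    push Not at hlt
    have := (hrc i' (r i)).1 hlt
    have := (hrc i (r i)).2 (by omega)
    omega
  have canti : ∀ i i', i ≤ i' → c i' ≤ c i := by
    intro i i' h
    by_contra hlt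
    push Not at hlt
    have := (hrc (c i) i').2 hlt
    have := (hrc (c i) i).1 (by omega)
    omega
  have hc : ∀ j, c j ≤ m := by
    intro j
    by_contra hlt
    push Not at hlt
    have := (hrc m j).2 hlt
    have := hr m le_rfl
    omega
  set i := m-1-t with hi
  set f := fun j => (r i - j) + (c j - i) - 1 with hf
  set g := fun s => (r i + t) - (r (m-1-s) + s) with hg
  have hfi : Set.InjOn f (Finset.range (r i)) := by
    intro j hj j' hj' h
    simp at hj hj'
    have h1 := (hrc i j).1 hj
    have h2 := (hrc i j').1 hj'
    simp only [hf] at h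
    rcases lt_trichotomy j j' with h3 | h3 | h3
    · have := canti j j' h3.le; omega
    · exact h3
    · have := canti j' j h3.le; omega
  have hgi : Set.InjOn g (Finset.range t) := by
    intro s hs s' hs' h
    simp at hs hs'
    have h1 := hanti i (m-1-s) (by omega)
    have h2 := hanti i (m-1-s') (by omega)
    simp only [hg] at h
    rcases lt_trichotomy s s' with h3 | h3 | h3
    · have := hanti (m-1-s') (m-1-s) (by omega); omega
    · exact h3
    · have := hanti (m-1-s) (m-1-s') (by omega); omega
  have hdisj : Disjoint ((Finset.range (r i)).image f) ((Finset.range t).image g) := by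
    rw [Finset.disjoint_left]
    intro x hx hx'
    simp only [Finset.mem_image, Finset.mem_range] at hx hx'
    obtain ⟨j, hj, rfl⟩ := hx
    obtain ⟨s, hs, h⟩ := hx'
    have h1 := (hrc i j).1 hj
    have h2 := hanti i (m-1-s) (by omega)
    have h3 := hrc (m-1-s) j
    simp only [hf, hg] at h
    by_cases h4 : j < r (m-1-s)
    · have := h3.1 h4; omega
    · have : ¬ (m-1-s < c j) := fun h => h4 (h3.2 h)
      omega
  have hun : (Finset.range (r i)).image f ∪ (Finset.range t).image g = Finset.Icc 1 (r i + t) := by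
    apply Finset.eq_of_subset_of_card_le
    · intro x hx
      simp only [Finset.mem_union, Finset.mem_image, Finset.mem_range, Finset.mem_Icc] at hx ⊢
      rcases hx with ⟨j, hj, rfl⟩ | ⟨s, hs, rfl⟩
      · have h1 := (hrc i j).1 hj
        have := hc j
        simp only [hf]; omega
      · have h2 := hanti i (m-1-s) (by omega)
        simp only [hg]; omega
    · rw [Finset.card_union_of_disjoint hdisj, Finset.card_image_of_injOn hfi, Finset.card_image_of_injOn hgi]
      simp
  rw [← Finset.prod_Ico_id_eq_factorial, show Finset.Ico 1 (r i + t + 1) = Finset.Icc 1 (r i + t) from by ext; simp, ← hun, Finset.prod_union hdisj, Finset.prod_image hfi, Finset.prod_image hgi]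

/-- tableaux of row lengths r -/
def TabP (m : ℕ) (r : ℕ → ℕ) (f : ℕ → ℕ → ℕ) : Prop :=
    (∀ i j, ¬ j < r i → f i j = 0) ∧
    (∀ i j, j < r i → 1 ≤ f i j ∧ f i j ≤ m) ∧
    (∀ i j₁ j₂, j₁ ≤ j₂ → j₂ < r i → f i j₁ ≤ f i j₂) ∧
    (∀ i₁ i₂ j, i₁ < i₂ → j < r i₂ → f i₁ j < f i₂ j)

/-- extension by zero -/
def extz {m : ℕ} (κ : Fin m → ℕ) (i : ℕ) : ℕ := if h : i < m then κ ⟨i, h⟩ else 0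

/-- inner shape -/
noncomputable def inner' (m : ℕ) (r : ℕ → ℕ) (f : ℕ → ℕ → ℕ) (i : ℕ) : ℕ :=
  ((Finset.range (r i)).filter (fun j => f i j ≤ m)).card

lemma lt_inner {m : ℕ} {r : ℕ → ℕ} {f : ℕ → ℕ → ℕ}
    (hrow : ∀ i j₁ j₂, j₁ ≤ j₂ → j₂ < r i → f i j₁ ≤ f i j₂) (i j : ℕ) :
    j < inner' m r f i ↔ j < r i ∧ f i j ≤ m := by
  unfold inner'
  constructor
  · intro h
    by_contra hc
    have : (Finset.range (r i)).filter (fun j => f i j ≤ m) ⊆ Finset.range j := by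
      intro k hk
      simp only [Finset.mem_filter, Finset.mem_range] at hk ⊢
      by_contra hkj
      push Not at hkj
      exact hc ⟨by omega, (hrow i j k hkj hk.1).trans hk.2⟩
    have := Finset.card_le_card this
    simp at this
    omega
  · rintro ⟨h1, h2⟩
    have : Finset.range (j+1) ⊆ (Finset.range (r i)).filter (fun j => f i j ≤ m) := by
      intro k hk
      simp only [Finset.mem_filter, Finset.mem_range] at hk ⊢
      exact ⟨by omega, (hrow i k j (by omega) h1).trans h2⟩
    have := Finset.card_le_card this
    simp at this
    omega

lemma tab_ge {m : ℕ} {r : ℕ → ℕ} {f : ℕ → ℕ → ℕ} (hr : Antitone r) (h : TabP m r f) (i j : ℕ)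
    (hj : j < r i) : i + 1 ≤ f i j := by
  induction i with
  | zero => exact (h.2.1 0 j hj).1
  | succ i ih =>
    have := ih (hj.trans_le (hr (Nat.le_succ i)))
    have := h.2.2.2 i (i+1) j (Nat.lt_succ_self i) hj
    omega

lemma extz_inner {m : ℕ} {r : ℕ → ℕ} {f : ℕ → ℕ → ℕ} (hr : Antitone r)
    (h : TabP (m+1) r f) : extz (fun i : Fin m => inner' m r f i) = inner' m r f := by
  funext i
  unfold extz
  split_ifs with hi
  · rfl
  · by_contra hne
    have := (lt_inner h.2.2.1 i 0 (m := m)).1 (by omega)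
    have := tab_ge hr h i 0 this.1
    omega

lemma inner_eq {m : ℕ} {r : ℕ → ℕ} {f : ℕ → ℕ → ℕ}
    (hrow : ∀ i j₁ j₂, j₁ ≤ j₂ → j₂ < r i → f i j₁ ≤ f i j₂) (i k : ℕ)
    (h : ∀ j, j < k ↔ j < r i ∧ f i j ≤ m) : inner' m r f i = k := by
  have h1 := fun j => (lt_inner hrow i j (m := m)).trans (h j).symm
  have := h1 k
  have := h1 (inner' m r f i)
  omega

lemma tab_trunc {m : ℕ} {r : ℕ → ℕ} {f : ℕ → ℕ → ℕ} (h : TabP (m+1) r f) :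
    TabP m (inner' m r f) (fun i j => if f i j ≤ m then f i j else 0) := by
  obtain ⟨h0, h1, h2, h3⟩ := h
  simp only [TabP, lt_inner h2]
  refine ⟨?_, ?_, ?_, ?_⟩
  · intro i j hj
    by_cases hr : j < r i
    · simp [hr] at hj; simp; omega
    · simp [h0 i j hr]
  · rintro i j ⟨ha, hb⟩
    simp only [hb, if_true, and_true]
    exact (h1 i j ha).1
  · rintro i j₁ j₂ hj ⟨ha, hb⟩
    have := h2 i j₁ j₂ hj ha
    simp [hb, this.trans hb, this]
  · rintro i₁ i₂ j hi ⟨ha, hb⟩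
    have := h3 i₁ i₂ j hi ha
    simp [hb, this.le.trans hb, this]

/-- glue -/
def glue (m : ℕ) (r κ : ℕ → ℕ) (g : ℕ → ℕ → ℕ) (i j : ℕ) : ℕ :=
  if j < κ i then g i j else if j < r i then m+1 else 0

lemma tab_glue {m : ℕ} {r κ : ℕ → ℕ} {g : ℕ → ℕ → ℕ} (hr : Antitone r) (hκ1 : ∀ i, κ i ≤ r i)
    (hκ2 : ∀ i, r (i+1) ≤ κ i) (h : TabP m κ g) : TabP (m+1) r (glue m r κ g) := by
  obtain ⟨h0, h1, h2, h3⟩ := h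
  refine ⟨?_, ?_, ?_, ?_⟩
  · intro i j hj
    have := hκ1 i
    simp only [glue, hj, if_false, ite_eq_right_iff]; omega
  · intro i j hj
    unfold glue
    split_ifs with ha
    · have := h1 i j ha; omega
    · omega
  · intro i j₁ j₂ hj ha
    unfold glue
    split_ifs with hb hc hc <;> try omega
    · exact h2 i j₁ j₂ hj hc
    · have := h1 i j₁ hb; omega
  · intro i₁ i₂ j hi ha
    have hb : j < κ i₁ := lt_of_lt_of_le ha ((hr (Nat.succ_le_of_lt hi)).trans (hκ2 i₁))
    simp only [glue, hb, if_true, ha]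
    split_ifs with hc
    · exact h3 i₁ i₂ j hi hc
    · have := h1 i₁ j hb; omega

lemma inner_glue {m : ℕ} {r κ : ℕ → ℕ} {g : ℕ → ℕ → ℕ} (hr : Antitone r) (hκ1 : ∀ i, κ i ≤ r i)
    (hκ2 : ∀ i, r (i+1) ≤ κ i) (h : TabP m κ g) : inner' m r (glue m r κ g) = κ := by
  have h' := tab_glue hr hκ1 hκ2 h
  funext i
  apply inner_eq h'.2.2.1
  intro j
  have := hκ1 i
  constructor
  · intro hj
    have := h.2.1 i j hj
    simp only [glue, hj, if_true]; omega
  · rintro ⟨ha, hb⟩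
    by_contra hc
    simp [glue, hc, ha] at hb

lemma tab_finite (m : ℕ) (r : ℕ → ℕ) (hr : Antitone r) (h0 : ∀ i, m ≤ i → r i = 0) :
    Finite {f : ℕ → ℕ → ℕ // TabP m r f} := by
  let F : {f : ℕ → ℕ → ℕ // TabP m r f} → (Fin m → Fin (r 0) → Fin (m+1)) := fun f i j =>
    ⟨f.1 i j, by
      by_cases hj : (j : ℕ) < r i
      · have := f.2.2.1 i j hj; omega
      · have := f.2.1 i j hj; omega⟩
  apply Finite.of_injective F
  intro f g hfg
  apply Subtype.ext
  funext i j
  by_cases hj : j < r i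
  · have hi : i < m := by
      by_contra hi
      have := h0 i (by omega)
      omega
    have := congrFun (congrFun hfg ⟨i, hi⟩) ⟨j, hj.trans_le (hr (Nat.zero_le i))⟩
    simpa [F] using this
  · rw [f.2.1 i j hj, g.2.1 i j hj]

lemma tab_branch (m : ℕ) (r : ℕ → ℕ) (hr : Antitone r) (h0 : ∀ i, m + 1 ≤ i → r i = 0) :
    Nat.card {f : ℕ → ℕ → ℕ // TabP (m+1) r f} =
      ∑ κ ∈ Fintype.piFinset (fun i : Fin m => Finset.Icc (r (i+1)) (r i)),
        Nat.card {f : ℕ → ℕ → ℕ // TabP m (extz κ) f} := by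
  have key : ∀ κ ∈ Fintype.piFinset (fun i : Fin m => Finset.Icc (r (i+1)) (r i)),
      (∀ i, extz κ i ≤ r i) ∧ (∀ i, r (i+1) ≤ extz κ i) := by
    intro κ hκ
    simp only [Fintype.mem_piFinset, Finset.mem_Icc] at hκ
    constructor <;> intro i <;> unfold extz <;> split_ifs with hi
    · exact (hκ ⟨i, hi⟩).2
    · omega
    · exact (hκ ⟨i, hi⟩).1
    · rw [h0 (i+1) (by omega)]
  have hanti : ∀ κ ∈ Fintype.piFinset (fun i : Fin m => Finset.Icc (r (i+1)) (r i)),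
      Antitone (extz κ) := by
    intro κ hκ
    apply antitone_nat_of_succ_le
    intro i
    exact ((key κ hκ).1 (i+1)).trans ((key κ hκ).2 i)
  rw [← Finset.sum_coe_sort]
  have : ∀ κ : Fintype.piFinset (fun i : Fin m => Finset.Icc (r (i+1)) (r i)),
      Finite {f : ℕ → ℕ → ℕ // TabP m (extz κ.1) f} := fun κ =>
    tab_finite _ _ (hanti _ κ.2) (by intro i hi; unfold extz; rw [dif_neg (by omega)])
  rw [← Nat.card_sigma (β := fun κ : Fintype.piFinset (fun i : Fin m => Finset.Icc (r (i+1)) (r i)) => {f : ℕ → ℕ → ℕ // TabP m (extz κ.1) f})]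
  symm
  apply Nat.card_eq_of_bijective
    (fun x => (⟨glue m r (extz x.1.1) x.2.1,
      tab_glue hr (key _ x.1.2).1 (key _ x.1.2).2 x.2.2⟩ : {f : ℕ → ℕ → ℕ // TabP (m+1) r f}))
  constructor
  · rintro ⟨⟨κ, hκ⟩, ⟨f, hf⟩⟩ ⟨⟨κ', hκ'⟩, ⟨f', hf'⟩⟩ h
    simp only [Subtype.mk.injEq] at h
    have h1 := inner_glue hr (key _ hκ).1 (key _ hκ).2 hf
    have h2 := inner_glue hr (key _ hκ').1 (key _ hκ').2 hf'
    have h3 : extz κ = extz κ' := by rw [← h1, ← h2]; simp only [h]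
    have h4 : κ = κ' := by
      funext i
      have := congrFun h3 i
      simpa [extz] using this
    subst h4
    have h5 : f = f' := by
      funext i j
      by_cases hj : j < extz κ i
      · have := congrFun (congrFun h i) j
        simpa [glue, hj] using this
      · rw [hf.1 i j hj, hf'.1 i j hj]
    subst h5
    rfl
  · rintro ⟨f, hf⟩
    have hm : (fun i : Fin m => inner' m r f i) ∈
        Fintype.piFinset (fun i : Fin m => Finset.Icc (r (i+1)) (r i)) := by
      simp only [Fintype.mem_piFinset, Finset.mem_Icc]
      intro i
      constructor
      · by_contra hlt
        push Not at hlt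
        have h1 := hf.2.2.2 i (i+1) _ (Nat.lt_succ_self _) hlt
        have h2 := hf.2.1 (i+1) _ hlt
        have h3 := (lt_inner hf.2.2.1 i (inner' m r f i) (m := m)).2 ⟨hlt.trans_le (hr (Nat.le_succ _)), by omega⟩
        omega
      · by_contra hlt
        push Not at hlt
        have := ((lt_inner hf.2.2.1 i (r i) (m := m)).1 hlt).1
        omega
    refine ⟨⟨⟨_, hm⟩, ⟨fun i j => if f i j ≤ m then f i j else 0, ?_⟩⟩, ?_⟩
    · simp only [extz_inner hr hf]; exact tab_trunc hf
    · apply Subtype.ext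
      funext i j
      simp only [extz_inner hr hf, glue, lt_inner hf.2.2.1]
      by_cases hj : j < r i
      · have := hf.2.1 i j hj
        simp only [hj, true_and, if_true]
        split_ifs <;> omega
      · simp [hj, hf.1 i j hj]
lemma tab_det (m : ℕ) : ∀ (r : ℕ → ℕ) (_ : Antitone r) (_ : ∀ i, m ≤ i → r i = 0),
    (Nat.card {f : ℕ → ℕ → ℕ // TabP m r f} : ℤ) = binDet m (fun i => r (m-1-i) + i) := by
  induction m with
  | zero =>
    intro r hr h0
    have : Nat.card {f : ℕ → ℕ → ℕ // TabP 0 r f} = 1 := by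
      rw [Nat.card_eq_one_iff_unique]
      constructor
      · constructor
        rintro ⟨f, hf⟩ ⟨g, hg⟩
        apply Subtype.ext
        funext i j
        have := h0 i (Nat.zero_le _)
        exact (hf.1 i j (by omega)).trans (hg.1 i j (by omega)).symm
      · refine ⟨⟨fun _ _ => 0, ?_⟩⟩
        simp [TabP, h0]
    rw [this]; simp [binDet]
  | succ m ih =>
    intro r hr h0
    rw [tab_branch m r hr h0, binDet_succ]
    · rw [Nat.cast_sum]
      apply Finset.sum_nbij' (fun (κ : Fin m → ℕ) (i : Fin m) => κ (Fin.rev i) + (i : ℕ)) (fun (k : Fin m → ℕ) (i : Fin m) => k (Fin.rev i) - ((Fin.rev i : Fin m) : ℕ))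
      · intro κ hκ
        simp only [Fintype.mem_piFinset, Finset.mem_Icc, Finset.mem_Ico] at hκ ⊢
        intro i
        have h1 := hκ (Fin.rev i)
        have hi := i.2
        simp only [Fin.val_rev, Fin.val_castSucc, Fin.val_succ] at h1 ⊢
        rw [show m + 1 - 1 - (i:ℕ) = m - (i + 1) + 1 by omega, show m + 1 - 1 - ((i:ℕ)+1) = m - (i + 1) by omega]
        omega
      · intro k hk
        simp only [Fintype.mem_piFinset, Finset.mem_Icc, Finset.mem_Ico] at hk ⊢
        intro i
        have h1 := hk (Fin.rev i)
        have hi := i.2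
        simp only [Fin.val_rev, Fin.val_castSucc, Fin.val_succ] at h1 ⊢
        rw [show m + 1 - 1 - (m - ((i:ℕ) + 1)) = i + 1 by omega, show m + 1 - 1 - (m - ((i:ℕ)+1) + 1) = i by omega] at h1
        omega
      · intro κ hκ
        funext i
        simp
      · intro k hk
        simp only [Fintype.mem_piFinset, Finset.mem_Ico] at hk
        funext i
        have h1 := hk i
        simp only [Fin.val_castSucc] at h1
        simp only [Fin.rev_rev]
        omega
      · intro κ hκ
        simp only [Fintype.mem_piFinset, Finset.mem_Icc] at hκ
        rw [ih]
        · congr 1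
          funext i
          have hi := i.2
          have : m - 1 - (i:ℕ) < m := by omega
          simp only [extz, this, dif_pos]
          congr 2
          apply Fin.ext; simp only [Fin.val_rev]; omega
        · apply antitone_nat_of_succ_le
          intro i
          unfold extz
          by_cases h : i + 1 < m
          · have h2 : i < m := by omega
            rw [dif_pos h, dif_pos h2]
            exact (hκ ⟨i+1, h⟩).2.trans (hκ ⟨i, h2⟩).1
          · rw [dif_neg h]; exact Nat.zero_le _
        · intro i hi; unfold extz; rw [dif_neg (by omega)]
    · intro i
      have hi := i.2
      simp only [Fin.val_castSucc, Fin.val_succ]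
      have := hr (show m + 1 - 1 - ((i:ℕ)+1) ≤ m + 1 - 1 - i by omega)
      omega

lemma tab_main (m : ℕ) (r c : ℕ → ℕ) (hrc : ∀ i j, j < r i ↔ i < c j) (hr : Antitone r)
    (h0 : ∀ i, m ≤ i → r i = 0) :
    Nat.card {f : ℕ → ℕ → ℕ // TabP m r f} *
      ∏ i ∈ Finset.range m, ∏ j ∈ Finset.range (r i), ((r i - j) + (c j - i) - 1) =
      ∏ i ∈ Finset.range m, ∏ j ∈ Finset.range (r i), (m + j - i) := by
  have hA : (∏ t ∈ Finset.range m, t.factorial) * Nat.card {f : ℕ → ℕ → ℕ // TabP m r f} =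
      ∏ t ∈ Finset.range m, ∏ s ∈ Finset.range t, ((r (m-1-t) + t) - (r (m-1-s) + s)) := by
    zify
    rw [tab_det m r hr h0, binDet_mul' m (fun i => r (m-1-i) + i)]
    apply Finset.prod_congr rfl
    intro t ht
    apply Finset.prod_congr rfl
    intro s hs
    simp only [Finset.mem_range] at ht hs
    have := hr (show m-1-t ≤ m-1-s by omega)
    rw [Nat.cast_sub (by omega)]
  have hB := Finset.prod_congr (rfl : Finset.range m = Finset.range m)
    (fun t ht => row_hook r c hrc m t (Finset.mem_range.1 ht) h0)
  rw [Finset.prod_mul_distrib, ← hA,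
    Finset.prod_range_reflect (fun i => ∏ j ∈ Finset.range (r i), ((r i - j) + (c j - i) - 1))] at hB
  have hC : ∏ t ∈ Finset.range m, (r (m-1-t) + t).factorial = (∏ t ∈ Finset.range m, t.factorial) *
      ∏ i ∈ Finset.range m, ∏ j ∈ Finset.range (r i), (m + j - i) := by
    rw [← Finset.prod_range_reflect (fun i => ∏ j ∈ Finset.range (r i), (m + j - i)), ← Finset.prod_mul_distrib]
    apply Finset.prod_congr rfl
    intro t ht
    simp only [Finset.mem_range] at ht
    rw [add_comm, ← Nat.factorial_mul_ascFactorial, Nat.ascFactorial_eq_prod_range]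
    congr 1
    apply Finset.prod_congr rfl
    intro j _
    omega
  rw [hC] at hB
  have hpos : 0 < ∏ t ∈ Finset.range m, t.factorial := Finset.prod_pos fun t _ => Nat.factorial_pos t
  apply Nat.eq_of_mul_eq_mul_left hpos
  rw [← hB]; ring

lemma prod_cells_row {M : Type*} [CommMonoid M] (μ : YoungDiagram) (m : ℕ) (h0 : ∀ i, m ≤ i → μ.rowLen i = 0)
    (F : ℕ × ℕ → M) : ∏ c ∈ μ.cells, F c =
      ∏ i ∈ Finset.range m, ∏ j ∈ Finset.range (μ.rowLen i), F (i, j) := by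
  apply Finset.prod_finset_product
  rintro ⟨i, j⟩
  simp only [YoungDiagram.mem_cells, YoungDiagram.mem_iff_lt_rowLen, Finset.mem_range]
  constructor
  · intro h
    refine ⟨?_, h⟩
    by_contra hi
    have := h0 i (by omega)
    omega
  · exact fun h => h.2

lemma prod_cells_col {M : Type*} [CommMonoid M] (μ : YoungDiagram) (m : ℕ) (h0 : ∀ i, m ≤ i → μ.colLen i = 0)
    (F : ℕ × ℕ → M) : ∏ c ∈ μ.cells, F c =
      ∏ j ∈ Finset.range m, ∏ i ∈ Finset.range (μ.colLen j), F (i, j) := by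
  apply Finset.prod_finset_product_right
  rintro ⟨i, j⟩
  simp only [YoungDiagram.mem_cells, YoungDiagram.mem_iff_lt_colLen, Finset.mem_range]
  constructor
  · intro h
    refine ⟨?_, h⟩
    by_contra hi
    have := h0 j (by omega)
    omega
  · exact fun h => h.2

lemma Tcount_eq (μ : YoungDiagram) (m : ℕ) (h0 : ∀ i, m ≤ i → μ.rowLen i = 0) :
    Tcount μ m * ∏ c ∈ μ.cells, hookLen μ c.1 c.2 = ∏ c ∈ μ.cells, (m + c.2 - c.1) := by
  have h1 : Tcount μ m = Nat.card {f : ℕ → ℕ → ℕ // TabP m μ.rowLen f} := by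
    simp only [Tcount, YoungDiagram.mem_iff_lt_rowLen]; rfl
  rw [h1, prod_cells_row μ m h0, prod_cells_row μ m h0]
  exact tab_main m μ.rowLen μ.colLen
    (fun i j => by rw [← YoungDiagram.mem_iff_lt_rowLen, YoungDiagram.mem_iff_lt_colLen])
    (fun i j h => μ.rowLen_anti i j h) h0

lemma hook_transpose (μ : YoungDiagram) :
    ∏ c ∈ μ.transpose.cells, hookLen μ.transpose c.1 c.2 = ∏ c ∈ μ.cells, hookLen μ c.1 c.2 := by
  apply Finset.prod_nbij' (fun c => c.swap) (fun c => c.swap)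
  · rintro ⟨i, j⟩; simp
  · rintro ⟨i, j⟩; simp
  · simp
  · simp
  · rintro ⟨i, j⟩ _
    simp only [hookLen, YoungDiagram.rowLen_transpose, YoungDiagram.colLen_transpose, Prod.swap]
    omega

lemma hook_pos (μ : YoungDiagram) : 0 < ∏ c ∈ μ.cells, hookLen μ c.1 c.2 := by
  apply Finset.prod_pos
  rintro ⟨i, j⟩ h
  have h1 := YoungDiagram.mem_iff_lt_rowLen.1 ((YoungDiagram.mem_cells _).1 h)
  have h2 := YoungDiagram.mem_iff_lt_colLen.1 ((YoungDiagram.mem_cells _).1 h)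
  simp only [hookLen]
  omega
lemma card_finEmb (k m : ℕ) : Nat.card (Fin k ↪o Fin m) = m.choose k := by
  rw [Nat.card_congr (Set.powersetCard.ofFinEmbEquiv (n := k) (I := Fin m)), Set.powersetCard.card]
  simp

lemma col_count (μ : YoungDiagram) (b : ℕ → ℕ) (D : ℕ) (h0 : ∀ j, D ≤ j → μ.colLen j = 0) :
    Nat.card {f : ℕ → ℕ → ℕ //
      (∀ i j, (i, j) ∉ μ → f i j = 0) ∧
      (∀ i j, (i, j) ∈ μ → 1 ≤ f i j ∧ f i j ≤ b j) ∧
      (∀ i₁ i₂ j, i₁ < i₂ → (i₂, j) ∈ μ → f i₁ j < f i₂ j)} =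
    ∏ j ∈ Finset.range D, (b j).choose (μ.colLen j) := by
  have h1 : Nat.card (∀ j : Fin D, Fin (μ.colLen j) ↪o Fin (b j)) =
      ∏ j ∈ Finset.range D, (b j).choose (μ.colLen j) := by
    rw [Nat.card_pi, ← Fin.prod_univ_eq_prod_range (fun j => (b j).choose (μ.colLen j))]
    simp only [card_finEmb]
  rw [← h1]
  simp only [YoungDiagram.mem_iff_lt_colLen]
  have hD : ∀ i j, i < μ.colLen j → j < D := by
    intro i j h
    by_contra hc
    have := h0 j (by omega)
    omega
  symm
  apply Nat.card_eq_of_bijective (fun φ => ⟨fun i j =>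
    if h : i < μ.colLen j then (φ ⟨j, hD i j h⟩ ⟨i, h⟩ : ℕ) + 1 else 0, by
      refine ⟨?_, ?_, ?_⟩
      · intro i j h; dsimp only; rw [dif_neg h]
      · intro i j h; dsimp only; rw [dif_pos h]
        have := (φ ⟨j, hD i j h⟩ ⟨i, h⟩).2
        simp only at this
        omega
      · intro i₁ i₂ j h h2
        dsimp only
        rw [dif_pos h2, dif_pos (h.trans h2)]
        have : φ ⟨j, hD i₂ j h2⟩ ⟨i₁, h.trans h2⟩ < φ ⟨j, hD i₂ j h2⟩ ⟨i₂, h2⟩ :=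
          (φ ⟨j, hD i₂ j h2⟩).strictMono (by simpa [Fin.lt_def] using h)
        rw [Fin.lt_def] at this
        omega⟩)
  constructor
  · intro φ ψ h
    simp only [Subtype.mk.injEq] at h
    funext j
    ext i
    have := congrFun (congrFun h i) j
    simpa using this
  · rintro ⟨f, hf0, hf1, hf2⟩
    refine ⟨fun j => OrderEmbedding.ofStrictMono (fun i => ⟨f i j - 1, ?_⟩) ?_, ?_⟩
    · have := hf1 i j i.2; omega
    · intro i i' h
      have h1 := hf2 i i' j h i'.2
      have h2 := hf1 i j i.2
      have h3 := hf1 i' j i'.2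
      simp only [Fin.lt_def]
      omega
    · apply Subtype.ext
      funext i j
      simp only
      split_ifs with h
      · have := hf1 i j h
        change f i j - 1 + 1 = f i j
        omega
      · rw [hf0 i j h]

lemma chain_le (g : ℕ → ℕ) (k : ℕ) (h : ∀ i₁ i₂, i₁ < i₂ → i₂ < k → g i₁ < g i₂) (i₁ i₂ : ℕ)
    (h1 : i₁ ≤ i₂) (h2 : i₂ < k) : g i₁ + (i₂ - i₁) ≤ g i₂ := by
  induction i₂, h1 using Nat.le_induction with
  | base => simp
  | succ i hi ih =>
    have := ih (by omega)
    have := h i (i+1) (by omega) h2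
    omega

lemma TR_count (μ : YoungDiagram) (d : ℕ) (h0 : ∀ j, d + 1 ≤ j → μ.colLen j = 0) :
    TRcount μ.transpose d = ∏ j ∈ Finset.range (d+1), (d - j + μ.colLen j).choose (μ.colLen j) := by
  rw [← col_count μ (fun j => d - j + μ.colLen j) (d+1) h0]
  simp only [TRcount, YoungDiagram.mem_iff_lt_colLen, YoungDiagram.colLen_transpose]
  have hT : ∀ i j, j < μ.rowLen i ↔ i < μ.colLen j := by
    intro i j
    rw [← YoungDiagram.mem_iff_lt_rowLen, YoungDiagram.mem_iff_lt_colLen]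
  simp only [hT]
  have hD : ∀ i j, i < μ.colLen j → j < d + 1 := by
    intro i j h
    by_contra hc
    have := h0 j (by omega)
    omega
  apply Nat.card_congr
  refine ⟨fun f => ⟨fun i j => if i < μ.colLen j then f.1 j i + i - j else 0, ?_⟩,
    fun g => ⟨fun j i => if i < μ.colLen j then g.1 i j + j - i else 0, ?_⟩, ?_, ?_⟩
  · obtain ⟨f, hf0, hf1, hf2⟩ := f
    refine ⟨?_, ?_, ?_⟩
    · intro i j h; simp [h]
    · intro i j h
      have := hf1 j i h
      have := hD i j h
      simp only [h, if_true]; omega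
    · intro i₁ i₂ j h h2
      have h3 := hf2 j i₁ i₂ h.le h2
      have := hf1 j i₁ (h.trans h2)
      simp only [h2, h.trans h2, if_true]; omega
  · obtain ⟨g, hg0, hg1, hg2⟩ := g
    refine ⟨?_, ?_, ?_⟩
    · intro i j h; simp [h]
    · intro j i h
      have h1 := hD i j h
      have h2 := chain_le (fun i => g i j) _ (fun i₁ i₂ => hg2 i₁ i₂ j) 0 i (Nat.zero_le _) h
      have h3 := chain_le (fun i => g i j) _ (fun i₁ i₂ => hg2 i₁ i₂ j) i (μ.colLen j - 1) (by omega) (by omega)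
      have h4 := hg1 0 j (by omega)
      have h5 := hg1 (μ.colLen j - 1) j (by omega)
      simp only [h, if_true]
      omega
    · intro j i₁ i₂ h h2
      have h3 := chain_le (fun i => g i j) _ (fun i₁ i₂ => hg2 i₁ i₂ j) i₁ i₂ h h2
      simp only [h2, lt_of_le_of_lt h h2, if_true]
      omega
  · rintro ⟨f, hf0, hf1, hf2⟩
    apply Subtype.ext
    funext j i
    simp only
    split_ifs with h
    · have := hf1 j i h; omega
    · rw [hf0 j i h]
  · rintro ⟨g, hg0, hg1, hg2⟩
    apply Subtype.ext
    funext i j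
    simp only
    split_ifs with h
    · have h2 := chain_le (fun i => g i j) _ (fun i₁ i₂ => hg2 i₁ i₂ j) 0 i (Nat.zero_le _) h
      omega
    · rw [hg0 i j h]

lemma TC_mul (μ : YoungDiagram) (b : ℕ → ℕ) (D : ℕ) (h0 : ∀ j, D ≤ j → μ.colLen j = 0) :
    (∏ j ∈ Finset.range D, (b j).choose (μ.colLen j)) * ∏ j ∈ Finset.range D, (μ.colLen j).factorial =
      ∏ c ∈ μ.cells, (b c.2 - c.1) := by
  rw [prod_cells_col μ D h0, ← Finset.prod_mul_distrib]
  apply Finset.prod_congr rfl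
  intro j _
  rw [mul_comm, ← Nat.descFactorial_eq_factorial_mul_choose, Nat.descFactorial_eq_prod_range]

lemma TR_mul (μ : YoungDiagram) (d : ℕ) (h0 : ∀ j, d + 1 ≤ j → μ.colLen j = 0) :
    TRcount μ.transpose d * ∏ j ∈ Finset.range (d+1), (μ.colLen j).factorial =
      ∏ c ∈ μ.transpose.cells, (d + 1 + c.2 - c.1) := by
  rw [TR_count μ d h0, prod_cells_row μ.transpose (d+1) (by simpa using h0), ← Finset.prod_mul_distrib]
  apply Finset.prod_congr rfl
  intro j hj
  simp only [Finset.mem_range] at hj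
  rw [mul_comm, ← Nat.descFactorial_eq_factorial_mul_choose, Nat.add_descFactorial_eq_ascFactorial,
    Nat.ascFactorial_eq_prod_range, YoungDiagram.rowLen_transpose]
  apply Finset.prod_congr rfl
  intro i _
  omega
lemma inj_count {C : Type*} [Fintype C] (n : ℕ) (hn : Fintype.card C = n) (N : ℕ)
    (Q : (C → ℕ) → Prop)
    (hQ : ∀ f g : C → ℕ, (∀ a b, f a < f b ↔ g a < g b) → (Q f → Q g)) :
    Nat.card {g : C → Fin N // Function.Injective g ∧ Q (fun c => g c)} =
      N.choose n * Nat.card {g : C → Fin n // Function.Injective g ∧ Q (fun c => g c)} := by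
  rw [← card_finEmb, ← Nat.card_prod]
  symm
  apply Nat.card_eq_of_bijective (fun x => ⟨fun c => x.1 (x.2.1 c),
    x.1.injective.comp x.2.2.1, hQ _ _ (fun a b => by simp) x.2.2.2⟩)
  constructor
  · rintro ⟨φ, g, hg, hg2⟩ ⟨ψ, g', hg', hg2'⟩ h
    simp only [Subtype.mk.injEq] at h
    have hb : Function.Surjective g := ((Fintype.bijective_iff_injective_and_card g).2 ⟨hg, by simp [hn]⟩).2
    have hb' : Function.Surjective g' := ((Fintype.bijective_iff_injective_and_card g').2 ⟨hg', by simp [hn]⟩).2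
    have h1 : Set.range φ = Set.range ψ := by
      rw [← hb.range_comp φ, ← hb'.range_comp ψ]
      exact congrArg Set.range h
    have h2 : φ = ψ := OrderEmbedding.range_inj.1 h1
    subst h2
    have h3 : g = g' := by
      funext c
      exact φ.injective (congrFun h c)
    subst h3
    rfl
  · rintro ⟨f, hf, hf2⟩
    classical
    have hs : (Finset.univ.image f).card = n := by
      rw [Finset.card_image_of_injective _ hf, Finset.card_univ, hn]
    have hx : ∀ c, ∃ k, (Finset.univ.image f).orderEmbOfFin hs k = f c := by
      intro c
      have : f c ∈ Set.range ((Finset.univ.image f).orderEmbOfFin hs) := by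
        rw [Finset.range_orderEmbOfFin]; simp
      exact this
    choose g hg using hx
    refine ⟨⟨(Finset.univ.image f).orderEmbOfFin hs, g, ?_, ?_⟩, ?_⟩
    · intro a b hab
      apply hf
      rw [← hg a, ← hg b, hab]
    · refine hQ _ _ (fun a b => ?_) hf2
      rw [← hg a, ← hg b]
      simp
    · apply Subtype.ext
      funext c
      exact hg c

lemma all_count {C : Type*} [Fintype C] (n : ℕ) (hn : Fintype.card C = n) (N : ℕ)
    (Q : (C → Fin N) → Prop) :
    Nat.card {g : C → Fin N // Function.Injective g ∧ Q g} ≤ Nat.card {g : C → Fin N // Q g} ∧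
    Nat.card {g : C → Fin N // Q g} + N.descFactorial n ≤
      Nat.card {g : C → Fin N // Function.Injective g ∧ Q g} + N ^ n := by
  classical
  simp only [Nat.card_eq_fintype_card, Fintype.card_subtype]
  constructor
  · apply Finset.card_le_card
    intro g; simp
  · have h1 : N.descFactorial n = (Finset.univ.filter (fun g : C → Fin N => Function.Injective g)).card := by
      rw [← Fintype.card_subtype, Fintype.card_congr (Equiv.subtypeInjectiveEquivEmbedding C (Fin N)),
        Fintype.card_embedding_eq]
      simp [hn]
    have h2 : N ^ n = (Finset.univ : Finset (C → Fin N)).card := by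
      rw [Finset.card_univ]; simp [hn]
    rw [h1, h2, ← Finset.card_union_add_card_inter, add_comm]
    apply Nat.add_le_add
    · apply Finset.card_le_card
      intro g; simp; tauto
    · apply Finset.card_le_card
      exact Finset.subset_univ _

/-- extension of a cell filling, shifted by one -/
def extC (μ : YoungDiagram) (g : μ.cells → ℕ) (i j : ℕ) : ℕ :=
  if h : (i, j) ∈ μ.cells then g ⟨(i, j), h⟩ + 1 else 0

lemma transport (μ : YoungDiagram) (N : ℕ) (R : (ℕ → ℕ → ℕ) → Prop) :
    Nat.card {f : ℕ → ℕ → ℕ // (∀ i j, (i, j) ∉ μ → f i j = 0) ∧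
      (∀ i j, (i, j) ∈ μ → 1 ≤ f i j ∧ f i j ≤ N) ∧ R f} =
    Nat.card {g : μ.cells → Fin N // R (extC μ (fun c => g c))} := by
  have key : ∀ f : ℕ → ℕ → ℕ, (∀ i j, (i, j) ∉ μ → f i j = 0) →
      (∀ i j, (i, j) ∈ μ → 1 ≤ f i j ∧ f i j ≤ N) →
      extC μ (fun c => f c.1.1 c.1.2 - 1) = f := by
    intro f h0 h1
    funext i j
    unfold extC
    split_ifs with h
    · have := h1 i j h
      simp only; omega
    · exact (h0 i j h).symm
  apply Nat.card_congr
  refine ⟨fun f => ⟨fun c => ⟨f.1 c.1.1 c.1.2 - 1, ?_⟩, ?_⟩,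
    fun g => ⟨extC μ (fun c => g.1 c), ?_, ?_, g.2⟩, ?_, ?_⟩
  · have := f.2.2.1 c.1.1 c.1.2 c.2
    omega
  · simp only
    rw [key f.1 f.2.1 f.2.2.1]
    exact f.2.2.2
  · intro i j h
    have : (i, j) ∉ μ.cells := h
    simp [extC, this]
  · intro i j h
    have : (i, j) ∈ μ.cells := h
    unfold extC
    rw [dif_pos this]
    have := (g.1 ⟨(i, j), this⟩).2
    dsimp only
    omega
  · intro f
    apply Subtype.ext
    exact key f.1 f.2.1 f.2.2.1
  · intro g
    apply Subtype.ext
    funext c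
    apply Fin.ext
    have : (c.1.1, c.1.2) ∈ μ.cells := c.2
    simp [extC]

lemma tendsto_prod_one {ι : Type*} (s : Finset ι) (x y : ι → ℕ) :
    Filter.Tendsto (fun N : ℕ => ((∏ c ∈ s, (N + x c - y c) : ℕ) : ℝ) / (N : ℝ) ^ s.card)
      Filter.atTop (nhds 1) := by
  have h1 : ∀ c ∈ s, Filter.Tendsto (fun N : ℕ => ((N + x c - y c : ℕ) : ℝ) / (N : ℝ))
      Filter.atTop (nhds 1) := by
    intro c _
    have h2 : Filter.Tendsto (fun N : ℕ => (1 : ℝ) + ((x c : ℝ) - y c) / (N : ℝ))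
      Filter.atTop (nhds (1 + 0)) :=
      tendsto_const_nhds.add (tendsto_const_div_atTop_nhds_zero_nat _)
    rw [add_zero] at h2
    refine h2.congr' ?_
    filter_upwards [Filter.eventually_ge_atTop (y c + 1)] with N hN
    have : (N : ℝ) ≠ 0 := by
      have : N ≠ 0 := by omega
      exact_mod_cast this
    rw [Nat.cast_sub (by omega)]
    push_cast
    field_simp
    ring
  have h3 := tendsto_finsetProd s h1
  simp only [Finset.prod_const_one] at h3
  refine h3.congr ?_
  intro N
  rw [Finset.prod_div_distrib, Finset.prod_const, Nat.cast_prod]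

lemma limit_count (μ : YoungDiagram) (Q : (ℕ → ℕ → ℕ) → Prop)
    (hQ : ∀ f g : ℕ → ℕ → ℕ, (∀ c ∈ μ, ∀ c' ∈ μ, (f c.1 c.2 < f c'.1 c'.2 ↔ g c.1 c.2 < g c'.1 c'.2)) →
      (Q f → Q g)) :
    Filter.Tendsto (fun N : ℕ => (Nat.card {f : ℕ → ℕ → ℕ // (∀ i j, (i, j) ∉ μ → f i j = 0) ∧
      (∀ i j, (i, j) ∈ μ → 1 ≤ f i j ∧ f i j ≤ N) ∧ Q f} : ℝ) / (N : ℝ) ^ μ.card) Filter.atTop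
      (nhds ((Nat.card {f : ℕ → ℕ → ℕ // (∀ i j, (i, j) ∉ μ → f i j = 0) ∧
        Set.BijOn (fun c : ℕ × ℕ => f c.1 c.2) ↑μ.cells (Set.Icc 1 μ.card) ∧ Q f} : ℝ)
          / (μ.card.factorial : ℝ))) := by
  have hE : Nat.card {f : ℕ → ℕ → ℕ // (∀ i j, (i, j) ∉ μ → f i j = 0) ∧
        Set.BijOn (fun c : ℕ × ℕ => f c.1 c.2) ↑μ.cells (Set.Icc 1 μ.card) ∧ Q f} =
      Nat.card {g : μ.cells → Fin μ.card // Function.Injective g ∧ Q (extC μ (fun c => g c))} := by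
    have h1 : ∀ f : ℕ → ℕ → ℕ, ((∀ i j, (i, j) ∉ μ → f i j = 0) ∧
        Set.BijOn (fun c : ℕ × ℕ => f c.1 c.2) ↑μ.cells (Set.Icc 1 μ.card) ∧ Q f) ↔
        ((∀ i j, (i, j) ∉ μ → f i j = 0) ∧ (∀ i j, (i, j) ∈ μ → 1 ≤ f i j ∧ f i j ≤ μ.card) ∧
          (Set.InjOn (fun c : ℕ × ℕ => f c.1 c.2) ↑μ.cells ∧ Q f)) := by
      intro f
      constructor
      · rintro ⟨a, b, c⟩
        exact ⟨a, fun i j h => b.mapsTo (show (i, j) ∈ (μ.cells : Set (ℕ × ℕ)) from h), b.injOn, c⟩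
      · rintro ⟨a, b, c, e⟩
        have hm : Set.MapsTo (fun c : ℕ × ℕ => f c.1 c.2) ↑μ.cells (Set.Icc 1 μ.card) :=
          fun x hx => b x.1 x.2 hx
        refine ⟨a, ⟨hm, c, ?_⟩, e⟩
        rw [← Finset.coe_Icc] at hm ⊢
        exact Finset.surjOn_of_injOn_of_card_le _ hm c (by simp [YoungDiagram.card])
    simp only [h1]
    rw [transport μ μ.card (fun f => Set.InjOn (fun c : ℕ × ℕ => f c.1 c.2) ↑μ.cells ∧ Q f)]
    have h2 : ∀ g : μ.cells → Fin μ.card, Set.InjOn (fun c : ℕ × ℕ => extC μ (fun c => g c) c.1 c.2) ↑μ.cells ↔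
        Function.Injective g := by
      intro g
      rw [Set.injOn_iff_injective, ← Function.Injective.of_comp_iff (f := fun x : Fin μ.card => (x : ℕ) + 1)
        (fun a b h => Fin.ext (by simpa using h))]
      apply iff_of_eq
      congr 1
      funext c
      have : (c.1.1, c.1.2) ∈ μ.cells := c.2
      simp [extC]
    simp only [h2]
  have hQ' : ∀ f g : μ.cells → ℕ, (∀ a b, f a < f b ↔ g a < g b) → (Q (extC μ f) → Q (extC μ g)) := by
    intro f g h
    apply hQ
    intro c hc c' hc'
    have h1 : (c.1, c.2) ∈ μ.cells := hc
    have h2 : (c'.1, c'.2) ∈ μ.cells := hc'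
    unfold extC
    rw [dif_pos h1, dif_pos h2, dif_pos h1, dif_pos h2]
    have := h ⟨_, h1⟩ ⟨_, h2⟩
    omega
  have hcard : Fintype.card μ.cells = μ.card := by simp [YoungDiagram.card]
  have hI := fun N => inj_count μ.card hcard N (fun g => Q (extC μ g)) hQ'
  simp only [transport μ _ Q, hE]
  set E := Nat.card {g : μ.cells → Fin μ.card // Function.Injective g ∧ Q (extC μ (fun c => g c))} with hEdef
  have hA : ∀ N : ℕ, N.choose μ.card * E ≤ Nat.card {g : μ.cells → Fin N // Q (extC μ (fun c => g c))} ∧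
      Nat.card {g : μ.cells → Fin N // Q (extC μ (fun c => g c))} + N.descFactorial μ.card ≤
        N.choose μ.card * E + N ^ μ.card := by
    intro N
    have h := all_count μ.card hcard N (fun g => Q (extC μ (fun c => g c)))
    have h' := hI N
    rw [h'] at h
    exact h
  clear_value E
  generalize hn : μ.card = n at *
  have hd : Filter.Tendsto (fun N : ℕ => (N.descFactorial n : ℝ) / (N : ℝ) ^ n) Filter.atTop (nhds 1) := by
    have := tendsto_prod_one (Finset.range n) (fun _ => 0) (fun i => i)
    simp only [add_zero, Finset.card_range] at this
    simpa only [Nat.descFactorial_eq_prod_range] using this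
  have hfac : (n.factorial : ℝ) ≠ 0 := by exact_mod_cast n.factorial_ne_zero
  have hch : ∀ N : ℕ, ((N.choose n * E : ℕ) : ℝ) / (N : ℝ) ^ n =
      ((N.descFactorial n : ℝ) / (N : ℝ) ^ n) * (E / n.factorial) := by
    intro N
    rw [Nat.descFactorial_eq_factorial_mul_choose]
    push_cast
    field_simp
  have hlo : Filter.Tendsto (fun N : ℕ => ((N.choose n * E : ℕ) : ℝ) / (N : ℝ) ^ n) Filter.atTop
      (nhds (E / n.factorial)) := by
    simp only [hch]
    simpa using hd.mul_const ((E : ℝ) / n.factorial)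
  have hhi : Filter.Tendsto (fun N : ℕ => ((N.choose n * E : ℕ) : ℝ) / (N : ℝ) ^ n +
      (1 - (N.descFactorial n : ℝ) / (N : ℝ) ^ n)) Filter.atTop
      (nhds (E / n.factorial)) := by
    simpa using hlo.add (hd.const_sub 1)
  refine tendsto_of_tendsto_of_tendsto_of_le_of_le' hlo hhi ?_ ?_
  · filter_upwards with N
    gcongr
    exact (hA N).1
  · filter_upwards [Filter.eventually_ge_atTop 1] with N hN
    have hp : (0 : ℝ) < (N : ℝ) ^ n := by
      have : (0 : ℝ) < N := by exact_mod_cast hN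
      positivity
    have h2 := (hA N).2
    have h3 : (Nat.card {g : μ.cells → Fin N // Q (extC μ (fun c => g c))} : ℝ) + N.descFactorial n ≤
      ((N.choose n * E : ℕ) : ℝ) + (N : ℝ) ^ n := by exact_mod_cast h2
    rw [div_le_iff₀ hp]
    have : (((N.choose n * E : ℕ) : ℝ) / (N : ℝ) ^ n + (1 - (N.descFactorial n : ℝ) / (N : ℝ) ^ n)) * (N : ℝ) ^ n =
      ((N.choose n * E : ℕ) : ℝ) + (N : ℝ) ^ n - N.descFactorial n := by field_simp; ring
    linarith
lemma limit_unique_nat (L : ℕ → ℕ) (E n H : ℕ) (P : ℕ → ℕ) (hH : 0 < H)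
    (h1 : Filter.Tendsto (fun N : ℕ => (L N : ℝ) / (N : ℝ) ^ n) Filter.atTop (nhds ((E : ℝ) / (n.factorial : ℝ))))
    (h2 : Filter.Tendsto (fun N : ℕ => (P N : ℝ) / (N : ℝ) ^ n) Filter.atTop (nhds 1))
    (h3 : ∀ᶠ N in Filter.atTop, L N * H = P N) : E * H = n.factorial := by
  have h4 : Filter.Tendsto (fun N : ℕ => (P N : ℝ) / (N : ℝ) ^ n) Filter.atTop
      (nhds ((E : ℝ) / (n.factorial : ℝ) * H)) := by
    refine (h1.mul_const (H : ℝ)).congr' ?_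
    filter_upwards [h3] with N hN
    rw [← hN]; push_cast; ring
  have h5 := tendsto_nhds_unique h4 h2
  have hfac : (n.factorial : ℝ) ≠ 0 := by exact_mod_cast n.factorial_ne_zero
  rw [div_mul_eq_mul_div, div_eq_one_iff_eq hfac] at h5
  exact_mod_cast h5

lemma syt_mul (μ : YoungDiagram) :
    sytCount μ * ∏ c ∈ μ.cells, hookLen μ c.1 c.2 = μ.card.factorial := by
  have hl := limit_count μ (fun f => (∀ i j₁ j₂, j₁ ≤ j₂ → (i, j₂) ∈ μ → f i j₁ ≤ f i j₂) ∧
    (∀ i₁ i₂ j, i₁ < i₂ → (i₂, j) ∈ μ → f i₁ j < f i₂ j)) (by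
      rintro f g h ⟨ha, hb⟩
      constructor
      · intro i j₁ j₂ hj hm
        have hm' := μ.up_left_mem le_rfl hj hm
        have h1 := ha i j₁ j₂ hj hm
        have h2 := h (i, j₂) hm (i, j₁) hm'
        simp only at h2
        omega
      · intro i₁ i₂ j hi hm
        have hm' := μ.up_left_mem hi.le le_rfl hm
        exact (h (i₁, j) hm' (i₂, j) hm).1 (hb i₁ i₂ j hi hm))
  have hE : sytCount μ = Nat.card {f : ℕ → ℕ → ℕ // (∀ i j, (i, j) ∉ μ → f i j = 0) ∧
        Set.BijOn (fun c : ℕ × ℕ => f c.1 c.2) ↑μ.cells (Set.Icc 1 μ.card) ∧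
        (∀ i j₁ j₂, j₁ ≤ j₂ → (i, j₂) ∈ μ → f i j₁ ≤ f i j₂) ∧
        (∀ i₁ i₂ j, i₁ < i₂ → (i₂, j) ∈ μ → f i₁ j < f i₂ j)} := by
    unfold sytCount
    apply Nat.card_congr
    apply Equiv.subtypeEquivRight
    intro f
    constructor
    · rintro ⟨a, b, c, e⟩
      refine ⟨a, b, ?_, e⟩
      intro i j₁ j₂ hj hm
      rcases hj.lt_or_eq with h | h
      · exact (c i j₁ j₂ h hm).le
      · rw [h]
    · rintro ⟨a, b, c, e⟩
      refine ⟨a, b, ?_, e⟩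
      intro i j₁ j₂ hj hm
      have hm' := μ.up_left_mem le_rfl hj.le hm
      refine lt_of_le_of_ne (c i j₁ j₂ hj.le hm) ?_
      intro heq
      have := b.injOn (show (i, j₁) ∈ (μ.cells : Set (ℕ × ℕ)) from hm')
        (show (i, j₂) ∈ (μ.cells : Set (ℕ × ℕ)) from hm) heq
      simp at this
      omega
  rw [← hE] at hl
  refine limit_unique_nat (fun N => Tcount μ N) _ _ _ (fun N => ∏ c ∈ μ.cells, (N + c.2 - c.1)) (hook_pos μ) hl
    (tendsto_prod_one μ.cells (fun c => c.2) (fun c => c.1)) ?_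
  filter_upwards [Filter.eventually_ge_atTop (μ.colLen 0)] with N hN
  apply Tcount_eq
  intro i hi
  by_contra hne
  have h1 : (i, 0) ∈ μ := YoungDiagram.mem_iff_lt_rowLen.2 (by omega)
  have h2 := YoungDiagram.mem_iff_lt_colLen.1 h1
  omega

lemma colStrict_mul (μ : YoungDiagram) (D : ℕ) (h0 : ∀ j, D ≤ j → μ.colLen j = 0) :
    colStrictBijCount μ * ∏ j ∈ Finset.range D, (μ.colLen j).factorial = μ.card.factorial := by
  have hl := limit_count μ (fun f =>
    (∀ i₁ i₂ j, i₁ < i₂ → (i₂, j) ∈ μ → f i₁ j < f i₂ j)) (by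
      intro f g h hb i₁ i₂ j hi hm
      have hm' := μ.up_left_mem hi.le le_rfl hm
      exact (h (i₁, j) hm' (i₂, j) hm).1 (hb i₁ i₂ j hi hm))
  refine limit_unique_nat _ _ _ _ (fun N => ∏ c ∈ μ.cells, (N + 0 - c.1))
    (Finset.prod_pos fun j _ => Nat.factorial_pos _) hl
    (tendsto_prod_one μ.cells (fun c => 0) (fun c => c.1)) ?_
  filter_upwards with N
  rw [col_count μ (fun _ => N) D h0, TC_mul μ (fun _ => N) D h0]
  simp

/-- The combinatorial result (final theorem of the paper): for `n_0 ≥ … ≥ n_d ≥ 1`,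
`μ` with conjugate partition `(n_0, …, n_d)`, `ν` with rows `(n_0, …, n_d)`, and
`N ≥ n_0`, the ratios `T(N,μ)/𝐓^C(N,μ)`, `T_0(μ')/𝐓_0^R(μ')`, `T^*(μ)/𝐓^*(μ)` all equal
`P(μ) = (n_0! ⋯ n_d!)/∏_{(i,j) ∈ μ} h(i,j)`. -/
theorem statement19 (d N : ℕ) (n : Fin (d + 1) → ℕ)
    (hmono : ∀ i j : Fin (d + 1), i ≤ j → n j ≤ n i) (hpos : ∀ i, 1 ≤ n i)
    (hN : n 0 ≤ N)
    (μ ν : YoungDiagram)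
    (hμ : ∀ i : ℕ, μ.colLen i = if h : i < d + 1 then n ⟨i, h⟩ else 0)
    (hν : ∀ i : ℕ, ν.rowLen i = if h : i < d + 1 then n ⟨i, h⟩ else 0) :
    (Tcount μ N : ℚ) / (TCcount μ N : ℚ) = (Tcount ν (d + 1) : ℚ) / (TRcount ν d : ℚ) ∧
    (Tcount ν (d + 1) : ℚ) / (TRcount ν d : ℚ) = (sytCount μ : ℚ) / (colStrictBijCount μ : ℚ) ∧
    (sytCount μ : ℚ) / (colStrictBijCount μ : ℚ)
      = (∏ i : Fin (d + 1), (Nat.factorial (n i) : ℚ)) /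
          ∏ c ∈ μ.cells, (hookLen μ c.1 c.2 : ℚ) := by
  have h0μ : ∀ j, d + 1 ≤ j → μ.colLen j = 0 := by
    intro j hj
    rw [hμ j, dif_neg (by omega)]
  have hνμ : ν = μ.transpose := by
    ext ⟨i, j⟩
    simp only [YoungDiagram.mem_cells, YoungDiagram.mem_iff_lt_rowLen, YoungDiagram.rowLen_transpose, hμ, hν]
  subst hνμ
  have hfac : ∏ i : Fin (d + 1), (Nat.factorial (n i) : ℚ) =
      ((∏ j ∈ Finset.range (d+1), (μ.colLen j).factorial : ℕ) : ℚ) := by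
    rw [← Fin.prod_univ_eq_prod_range (fun j => (μ.colLen j).factorial)]
    push_cast
    apply Finset.prod_congr rfl
    intro i _
    rw [hμ i, dif_pos i.2]
  have hF : 0 < ∏ j ∈ Finset.range (d+1), (μ.colLen j).factorial :=
    Finset.prod_pos fun j _ => Nat.factorial_pos _
  have hH := hook_pos μ
  have hcol0 : μ.colLen 0 ≤ N := by
    rw [hμ 0, dif_pos (by omega)]; exact hN
  have hrow : ∀ m, μ.colLen 0 ≤ m → ∀ i, m ≤ i → μ.rowLen i = 0 := by
    intro m hm i hi
    by_contra hne
    have h1 : (i, 0) ∈ μ := YoungDiagram.mem_iff_lt_rowLen.2 (by omega)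
    have h2 := YoungDiagram.mem_iff_lt_colLen.1 h1
    omega
  have ratio : ∀ (a b P : ℕ), 0 < P → a * (∏ c ∈ μ.cells, hookLen μ c.1 c.2) = P →
      b * (∏ j ∈ Finset.range (d+1), (μ.colLen j).factorial) = P →
      (a : ℚ) / (b : ℚ) = (∏ i : Fin (d + 1), (Nat.factorial (n i) : ℚ)) /
          ∏ c ∈ μ.cells, (hookLen μ c.1 c.2 : ℚ) := by
    intro a b P hP ha hb
    have hb0 : b ≠ 0 := by
      rintro rfl
      rw [zero_mul] at hb
      omega
    rw [hfac, ← Nat.cast_prod, div_eq_div_iff (by exact_mod_cast hb0) (by exact_mod_cast hH.ne')]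
    have := ha.trans hb.symm
    rw [mul_comm b] at this
    exact_mod_cast this
  have r1 : (Tcount μ N : ℚ) / (TCcount μ N : ℚ) = (∏ i : Fin (d + 1), (Nat.factorial (n i) : ℚ)) /
          ∏ c ∈ μ.cells, (hookLen μ c.1 c.2 : ℚ) := by
    refine ratio _ _ _ ?_ (Tcount_eq μ N (hrow N hcol0)) ?_
    · apply Finset.prod_pos
      rintro ⟨i, j⟩ hc
      have h1 := YoungDiagram.mem_iff_lt_colLen.1 ((YoungDiagram.mem_cells _).1 hc)
      have h2 := μ.colLen_anti 0 j (Nat.zero_le _)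
      simp only
      omega
    · rw [TCcount, col_count μ (fun j => N + j) (d+1) h0μ, TC_mul μ (fun j => N + j) (d+1) h0μ]
  have r2 : (Tcount μ.transpose (d+1) : ℚ) / (TRcount μ.transpose d : ℚ) =
      (∏ i : Fin (d + 1), (Nat.factorial (n i) : ℚ)) / ∏ c ∈ μ.cells, (hookLen μ c.1 c.2 : ℚ) := by
    refine ratio _ _ _ ?_ ?_ (TR_mul μ d h0μ)
    · apply Finset.prod_pos
      rintro ⟨i, j⟩ hc
      have h1 := YoungDiagram.mem_iff_lt_rowLen.1 ((YoungDiagram.mem_cells _).1 hc)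
      rw [YoungDiagram.rowLen_transpose] at h1
      have : i < d + 1 := by
        by_contra hlt
        have := h0μ i (by omega)
        omega
      simp only
      omega
    · rw [← hook_transpose]
      exact Tcount_eq μ.transpose (d+1) (by simpa using h0μ)
  have r3 : (sytCount μ : ℚ) / (colStrictBijCount μ : ℚ) =
      (∏ i : Fin (d + 1), (Nat.factorial (n i) : ℚ)) / ∏ c ∈ μ.cells, (hookLen μ c.1 c.2 : ℚ) :=
    ratio _ _ _ (Nat.factorial_pos μ.card) (syt_mul μ) (colStrict_mul μ (d+1) h0μ)
  exact ⟨r1.trans r2.symm, r2.trans r3.symm, r3⟩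
end
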